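/- Superconvergence of the MAC-E scheme for the normal stresses: there exist constants C > 0 and h₀ > 0, depending only on μ and the mesh-regularity constant C₀ (in particular independent of h and l), such that if max(h, l) ≤ h₀ and (W^x, W^y, Z^{11}, Z^{22}, Z^{12}) solves the MAC-E scheme with data f¹, f² computed from the exact solution, then ‖Z^{11} − σ̃^{11}‖_M + ‖Z^{22} − σ̃^{22}‖_M ≤ C(λ+μ)(h²+l²)(‖u‖_{3,∞} + ‖σ‖_{3,∞}). -/

import Mathlib

open Finset

noncomputable section

/-- The midpoint `x_{i+1/2} = (x_i + x_{i+1})/2`. -/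
def midpt (x : ℕ → ℝ) (i : ℕ) : ℝ := (x i + x (i + 1)) / 2

/-- The cell width `h_{i+1/2} = x_{i+1} - x_i`. -/
def hMid (x : ℕ → ℝ) (i : ℕ) : ℝ := x (i + 1) - x i

/-- `h_i = x_{i+1/2} - x_{i-1/2}` for `1 ≤ i ≤ n-1`, together with the boundary
conventions `h_0 = h_{1/2}/2` and `h_n = h_{n-1/2}/2`. -/
def hNode (x : ℕ → ℝ) (n i : ℕ) : ℝ :=
  if i = 0 then hMid x 0 / 2
  else if i = n then hMid x (n - 1) / 2
  else midpt x i - midpt x (i - 1)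

/-- `0 = x_0 < x_1 < ⋯ < x_n = 1`. -/
def IsGrid (x : ℕ → ℝ) (n : ℕ) : Prop :=
  x 0 = 0 ∧ x n = 1 ∧ ∀ i < n, x i < x (i + 1)

/-- Discrete inner product `(φ,θ)_M` over the cell centers `(x_{i+1/2}, y_{j+1/2})`. -/
def ipM (x y : ℕ → ℝ) (nx ny : ℕ) (φ θ : ℕ → ℕ → ℝ) : ℝ :=
  ∑ i ∈ range nx, ∑ j ∈ range ny, hMid x i * hMid y j * φ i j * θ i j

/-- Discrete inner product `(φ,θ)_T` over the grid nodes `(x_i, y_j)`. -/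
def ipT (x y : ℕ → ℝ) (nx ny : ℕ) (φ θ : ℕ → ℕ → ℝ) : ℝ :=
  ∑ i ∈ range (nx + 1), ∑ j ∈ range (ny + 1), hNode x nx i * hNode y ny j * φ i j * θ i j

/-- Discrete inner product `(φ,θ)_{TM}` over the points `(x_i, y_{j+1/2})`,
`1 ≤ i ≤ n_x - 1`, `0 ≤ j ≤ n_y - 1`. -/
def ipTM (x y : ℕ → ℝ) (nx ny : ℕ) (φ θ : ℕ → ℕ → ℝ) : ℝ :=
  ∑ i ∈ Ico 1 nx, ∑ j ∈ range ny, hNode x nx i * hMid y j * φ i j * θ i j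

/-- Discrete inner product `(φ,θ)_{MT}` over the points `(x_{i+1/2}, y_j)`,
`0 ≤ i ≤ n_x - 1`, `1 ≤ j ≤ n_y - 1`. -/
def ipMT (x y : ℕ → ℝ) (nx ny : ℕ) (φ θ : ℕ → ℕ → ℝ) : ℝ :=
  ∑ i ∈ range nx, ∑ j ∈ Ico 1 ny, hMid x i * hNode y ny j * φ i j * θ i j

/-- `D_y` of an edge function `v` given at `(x-index, y_{j+1/2})` with extra boundary
rows `v0` (at `y_0`) and `vn` (at `y_{n_y}`); the result is a node function. -/
def DyE (y : ℕ → ℝ) (ny : ℕ) (v : ℕ → ℕ → ℝ) (v0 vn : ℕ → ℝ) (i j : ℕ) : ℝ :=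
  if j = 0 then (v i 0 - v0 i) / hNode y ny 0
  else if j = ny then (vn i - v i (ny - 1)) / hNode y ny ny
  else (v i j - v i (j - 1)) / hNode y ny j

/-- `D_x` of an edge function `v` given at `(x_{i+1/2}, y-index)` with extra boundary
columns `v0` (at `x_0`) and `vn` (at `x_{n_x}`); the result is a node function. -/
def DxE (x : ℕ → ℝ) (nx : ℕ) (v : ℕ → ℕ → ℝ) (v0 vn : ℕ → ℝ) (i j : ℕ) : ℝ :=
  if i = 0 then (v 0 j - v0 j) / hNode x nx 0
  else if i = nx then (vn j - v (nx - 1) j) / hNode x nx nx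
  else (v i j - v (i - 1) j) / hNode x nx i

/-- The MAC-E scheme on the staggered grid: `(Wx, Wy, Z11, Z22, Z12)` (with the extra
boundary rows/columns `Wx0, Wxn` of `Wx` at `y = y_0, y_{n_y}` and `Wy0, Wyn` of `Wy`
at `x = x_0, x_{n_x}`) solves the scheme with data `f1, f2`. -/
def MACESol (nx ny : ℕ) (x y : ℕ → ℝ) (lam mu : ℝ)
    (Wx : ℕ → ℕ → ℝ) (Wx0 Wxn : ℕ → ℝ)
    (Wy : ℕ → ℕ → ℝ) (Wy0 Wyn : ℕ → ℝ)
    (Z11 Z22 Z12 f1 f2 : ℕ → ℕ → ℝ) : Prop :=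
  -- boundary conditions for the displacements
  (∀ j < ny, Wx 0 j = 0 ∧ Wx nx j = 0) ∧
  (∀ i ≤ nx, Wx0 i = 0 ∧ Wxn i = 0) ∧
  (∀ i < nx, Wy i 0 = 0 ∧ Wy i ny = 0) ∧
  (∀ j ≤ ny, Wy0 j = 0 ∧ Wyn j = 0) ∧
  -- constitutive equations at the cell centers
  (∀ i < nx, ∀ j < ny,
    (1 / (2 * mu)) * (Z11 i j - lam / (2 * lam + 2 * mu) * (Z11 i j + Z22 i j))
      = (Wx (i + 1) j - Wx i j) / hMid x i) ∧
  (∀ i < nx, ∀ j < ny,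
    (1 / (2 * mu)) * (Z22 i j - lam / (2 * lam + 2 * mu) * (Z11 i j + Z22 i j))
      = (Wy i (j + 1) - Wy i j) / hMid y j) ∧
  -- shear stress equation at the grid nodes
  (∀ i ≤ nx, ∀ j ≤ ny,
    Z12 i j = mu * (DyE y ny Wx Wx0 Wxn i j + DxE x nx Wy Wy0 Wyn i j)) ∧
  -- momentum equations
  (∀ i, 1 ≤ i → i < nx → ∀ j < ny,
    (Z11 i j - Z11 (i - 1) j) / hNode x nx i
      + (Z12 i (j + 1) - Z12 i j) / hMid y j = f1 i j) ∧
  (∀ i < nx, ∀ j, 1 ≤ j → j < ny →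
    (Z12 (i + 1) j - Z12 i j) / hMid x i
      + (Z22 i j - Z22 i (j - 1)) / hNode y ny j = f2 i j)

/-- First partial derivative in `x`. -/
def pdx (f : ℝ × ℝ → ℝ) (p : ℝ × ℝ) : ℝ := deriv (fun t => f (t, p.2)) p.1

/-- First partial derivative in `y`. -/
def pdy (f : ℝ × ℝ → ℝ) (p : ℝ × ℝ) : ℝ := deriv (fun t => f (p.1, t)) p.2

/-- The norm `‖f‖_{3,∞}`: the sup over `[0,1]²` of the derivatives of `f` of order at
most `3`. -/
def norm3 (f : ℝ × ℝ → ℝ) : ℝ :=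
  ⨆ p : Set.Icc ((0 : ℝ), (0 : ℝ)) ((1 : ℝ), (1 : ℝ)), ⨆ k : Fin 4,
    ‖iteratedFDeriv ℝ (k : ℕ) f (p : ℝ × ℝ)‖

/-- The mesh size `h = max_i h_{i+1/2}`. -/
def hmax (x : ℕ → ℝ) (n : ℕ) : ℝ := ⨆ i : Fin n, hMid x i

/-- The corrected cell-center interpolant
`σ̃_{i+1/2,j+1/2} = σ - (h_{i+1/2}²/8)∂²ₓσ - (l_{j+1/2}²/8)∂²_yσ` at `(x_{i+1/2}, y_{j+1/2})`. -/
def sigmaTilde (x y : ℕ → ℝ) (σ : ℝ × ℝ → ℝ) (i j : ℕ) : ℝ :=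
  σ (midpt x i, midpt y j)
    - (hMid x i) ^ 2 / 8 * pdx (pdx σ) (midpt x i, midpt y j)
    - (hMid y j) ^ 2 / 8 * pdy (pdy σ) (midpt x i, midpt y j)

/-- `g1, g2, g3` are the successive derivatives of `g`, and `g1, g2, g3` are bounded by `N`
on `[0,1]`. -/
structure DerivBounds (N : ℝ) (g g1 g2 g3 : ℝ → ℝ) : Prop where
  d1 : ∀ t, HasDerivAt g (g1 t) t
  d2 : ∀ t, HasDerivAt g1 (g2 t) t
  d3 : ∀ t, HasDerivAt g2 (g3 t) t
  b1 : ∀ t ∈ Set.Icc (0 : ℝ) 1, |g1 t| ≤ N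
  b2 : ∀ t ∈ Set.Icc (0 : ℝ) 1, |g2 t| ≤ N
  b3 : ∀ t ∈ Set.Icc (0 : ℝ) 1, |g3 t| ≤ N

lemma uIcc_subset_unit {a b : ℝ} (ha : a ∈ Set.Icc (0 : ℝ) 1) (hb : b ∈ Set.Icc (0 : ℝ) 1) :
    Set.uIcc a b ⊆ Set.Icc (0 : ℝ) 1 :=
  Set.uIcc_subset_Icc ha hb

lemma abs_sub_le_of_deriv_uIcc {g g' : ℝ → ℝ} {a b K : ℝ} (hg : ∀ t, HasDerivAt g (g' t) t)
    (hK : ∀ t ∈ Set.uIcc a b, |g' t| ≤ K) : |g b - g a| ≤ K * |b - a| :=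
  (convex_uIcc a b).norm_image_sub_le_of_norm_hasDerivWithin_le
    (fun t _ => (hg t).hasDerivWithinAt) hK Set.left_mem_uIcc Set.right_mem_uIcc

lemma abs_sub_left_le_of_mem_uIcc {a b t : ℝ} (ht : t ∈ Set.uIcc a b) : |t - a| ≤ |b - a| :=
  Set.abs_sub_left_of_mem_uIcc ht

lemma taylor_two {g g1 g2 : ℝ → ℝ} {a b N : ℝ} (h1 : ∀ t, HasDerivAt g (g1 t) t)
    (h2 : ∀ t, HasDerivAt g1 (g2 t) t) (hN : ∀ t ∈ Set.uIcc a b, |g2 t| ≤ N) :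
    |g b - g a - g1 a * (b - a)| ≤ N * |b - a| ^ 2 := by
  have hN0 : 0 ≤ N := (abs_nonneg _).trans (hN a Set.left_mem_uIcc)
  have key := abs_sub_le_of_deriv_uIcc (g := fun t => g t - g1 a * (t - a))
    (g' := fun t => g1 t - g1 a) (a := a) (b := b) (K := N * |b - a|)
    (fun t => by
      have h := (h1 t).sub (((hasDerivAt_id t).sub_const a).const_mul (g1 a))
      exact h.congr_deriv (by ring))
    (fun t ht => by
      have hsub : Set.uIcc a t ⊆ Set.uIcc a b := Set.uIcc_subset_uIcc_left ht
      exact (abs_sub_le_of_deriv_uIcc h2 fun s hs => hN s (hsub hs)).trans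
        (mul_le_mul_of_nonneg_left (abs_sub_left_le_of_mem_uIcc ht) hN0))
  calc |g b - g a - g1 a * (b - a)| = |g b - g1 a * (b - a) - (g a - g1 a * (a - a))| := by
        congr 1; ring
    _ ≤ N * |b - a| * |b - a| := key
    _ = N * |b - a| ^ 2 := by ring

lemma taylor_three {g g1 g2 g3 : ℝ → ℝ} {a b N : ℝ} (h1 : ∀ t, HasDerivAt g (g1 t) t)
    (h2 : ∀ t, HasDerivAt g1 (g2 t) t) (h3 : ∀ t, HasDerivAt g2 (g3 t) t)
    (hN : ∀ t ∈ Set.uIcc a b, |g3 t| ≤ N) :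
    |g b - g a - g1 a * (b - a) - g2 a / 2 * (b - a) ^ 2| ≤ N * |b - a| ^ 3 := by
  have hN0 : 0 ≤ N := (abs_nonneg _).trans (hN a Set.left_mem_uIcc)
  have key := abs_sub_le_of_deriv_uIcc
    (g := fun t => g t - g1 a * (t - a) - g2 a / 2 * (t - a) ^ 2)
    (g' := fun t => g1 t - g1 a - g2 a * (t - a)) (a := a) (b := b) (K := N * |b - a| ^ 2)
    (fun t => by
      have h := ((h1 t).sub (((hasDerivAt_id t).sub_const a).const_mul (g1 a))).sub
        ((((hasDerivAt_id t).sub_const a).pow 2).const_mul (g2 a / 2))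
      exact h.congr_deriv (by norm_num; ring))
    (fun t ht => by
      have hsub : Set.uIcc a t ⊆ Set.uIcc a b := Set.uIcc_subset_uIcc_left ht
      refine (taylor_two h2 h3 fun s hs => hN s (hsub hs)).trans
        (mul_le_mul_of_nonneg_left ?_ hN0)
      exact pow_le_pow_left₀ (abs_nonneg _) (abs_sub_left_le_of_mem_uIcc ht) 2)
  calc |g b - g a - g1 a * (b - a) - g2 a / 2 * (b - a) ^ 2|
      = |g b - g1 a * (b - a) - g2 a / 2 * (b - a) ^ 2
          - (g a - g1 a * (a - a) - g2 a / 2 * (a - a) ^ 2)| := by congr 1; ring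
    _ ≤ N * |b - a| ^ 2 * |b - a| := key
    _ = N * |b - a| ^ 3 := by ring

namespace DerivBounds

variable {N : ℝ} {g g1 g2 g3 : ℝ → ℝ}

lemma nonneg (h : DerivBounds N g g1 g2 g3) : 0 ≤ N :=
  (abs_nonneg _).trans (h.b1 0 (by simp))

lemma abs_corrected_sub_le (h : DerivBounds N g g1 g2 g3) {a m : ℝ}
    (ha : a ∈ Set.Icc (0 : ℝ) 1) (hm : m ∈ Set.Icc (0 : ℝ) 1) :
    |g m - (m - a) ^ 2 / 2 * g2 m - g a - g1 a * (m - a)| ≤ 2 * N * |m - a| ^ 3 := by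
  have hsub := uIcc_subset_unit ha hm
  have e1 := taylor_three h.d1 h.d2 h.d3 fun t ht => h.b3 t (hsub ht)
  have e2 := abs_sub_le_of_deriv_uIcc h.d3 fun t ht => h.b3 t (hsub ht)
  have e3 : |(m - a) ^ 2 / 2 * (g2 m - g2 a)| ≤ N * |m - a| ^ 3 := by
    rw [abs_mul, abs_of_nonneg (by positivity : 0 ≤ (m - a) ^ 2 / 2), ← sq_abs (m - a)]
    calc |m - a| ^ 2 / 2 * |g2 m - g2 a| ≤ |m - a| ^ 2 / 2 * (N * |m - a|) := by gcongr
      _ = N * |m - a| ^ 3 / 2 := by ring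
      _ ≤ N * |m - a| ^ 3 := half_le_self (mul_nonneg h.nonneg (by positivity))
  calc _ = |(g m - g a - g1 a * (m - a) - g2 a / 2 * (m - a) ^ 2)
          - (m - a) ^ 2 / 2 * (g2 m - g2 a)| := by congr 1; ring
    _ ≤ N * |m - a| ^ 3 + N * |m - a| ^ 3 := (abs_sub _ _).trans (add_le_add e1 e3)
    _ = _ := by ring

lemma abs_centered_sub_le (h : DerivBounds N g g1 g2 g3) {a b : ℝ}
    (ha : a ∈ Set.Icc (0 : ℝ) 1) (hb : b ∈ Set.Icc (0 : ℝ) 1) (hab : a < b) :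
    |(g b - g a) / (b - a) - g1 ((a + b) / 2)| ≤ N * (b - a) ^ 2 := by
  have hm : (a + b) / 2 ∈ Set.Icc (0 : ℝ) 1 :=
    ⟨by linarith [ha.1, hb.1], by linarith [ha.2, hb.2]⟩
  have e1 := taylor_three h.d1 h.d2 h.d3 fun t ht => h.b3 t (uIcc_subset_unit hm hb ht)
  have e2 := taylor_three h.d1 h.d2 h.d3 fun t ht => h.b3 t (uIcc_subset_unit hm ha ht)
  have h0 : 0 < b - a := sub_pos.2 hab
  have hN := h.nonneg
  rw [show b - (a + b) / 2 = (b - a) / 2 by ring, abs_of_pos (half_pos h0)] at e1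
  rw [show a - (a + b) / 2 = -((b - a) / 2) by ring, abs_neg, abs_of_pos (half_pos h0)] at e2
  rw [div_sub' h0.ne', abs_div, abs_of_pos h0, div_le_iff₀ h0]
  have h3 : 0 ≤ N * (b - a) ^ 3 := by positivity
  rw [abs_le] at *
  constructor <;> nlinarith [e1.1, e1.2, e2.1, e2.2]

end DerivBounds

/-- `f` is `C^n` and its derivatives of order at most `n` are bounded by `N` on `[0,1]²`. -/
def SquareBound (n : ℕ) (N : ℝ) (f : ℝ × ℝ → ℝ) : Prop :=
  ContDiff ℝ n f ∧ ∀ p ∈ Set.Icc ((0 : ℝ), (0 : ℝ)) ((1 : ℝ), (1 : ℝ)), ∀ k ≤ n,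
    ‖iteratedFDeriv ℝ k f p‖ ≤ N

lemma SquareBound.mono {n : ℕ} {M N : ℝ} {f : ℝ × ℝ → ℝ} (h : SquareBound n M f)
    (hMN : M ≤ N) : SquareBound n N f :=
  ⟨h.1, fun p hp k hk => (h.2 p hp k hk).trans hMN⟩

lemma hasDerivAt_slice_fst {f : ℝ × ℝ → ℝ} (hf : Differentiable ℝ f) (p : ℝ × ℝ) :
    HasDerivAt (fun t => f (t, p.2)) (fderiv ℝ f p (1, 0)) p.1 :=
  (hf p).hasFDerivAt.comp_hasDerivAt p.1 ((hasDerivAt_id p.1).prodMk (hasDerivAt_const p.1 p.2))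

lemma hasDerivAt_slice_snd {f : ℝ × ℝ → ℝ} (hf : Differentiable ℝ f) (p : ℝ × ℝ) :
    HasDerivAt (fun t => f (p.1, t)) (fderiv ℝ f p (0, 1)) p.2 :=
  (hf p).hasFDerivAt.comp_hasDerivAt p.2 ((hasDerivAt_const p.2 p.1).prodMk (hasDerivAt_id p.2))

lemma SquareBound.differentiable {n : ℕ} {N : ℝ} {f : ℝ × ℝ → ℝ} (h : SquareBound (n + 1) N f) :
    Differentiable ℝ f :=
  h.1.differentiable (by exact_mod_cast n.succ_ne_zero)

lemma SquareBound.fderiv_apply {n : ℕ} {N : ℝ} {f : ℝ × ℝ → ℝ} (h : SquareBound (n + 1) N f)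
    {v : ℝ × ℝ} (hv : ‖v‖ ≤ 1) : SquareBound n N (fun p => fderiv ℝ f p v) := by
  have hc : ContDiff ℝ n (fderiv ℝ f) := h.1.fderiv_right (by norm_cast)
  refine ⟨hc.clm_apply contDiff_const, fun p hp k hk => ?_⟩
  let L : (ℝ × ℝ →L[ℝ] ℝ) →L[ℝ] ℝ := ContinuousLinearMap.apply ℝ ℝ v
  have hL : ‖L‖ ≤ 1 := L.opNorm_le_bound zero_le_one fun A => by
    calc ‖L A‖ ≤ ‖A‖ * ‖v‖ := A.le_opNorm v
      _ ≤ ‖A‖ * 1 := by gcongr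
      _ = 1 * ‖A‖ := by ring
  calc ‖iteratedFDeriv ℝ k (fun p => fderiv ℝ f p v) p‖
      ≤ ‖L‖ * ‖iteratedFDeriv ℝ k (fderiv ℝ f) p‖ :=
        L.norm_iteratedFDeriv_comp_left hc.contDiffAt (by exact_mod_cast hk)
    _ ≤ 1 * ‖iteratedFDeriv ℝ k (fderiv ℝ f) p‖ := by gcongr
    _ = ‖iteratedFDeriv ℝ (k + 1) f p‖ := by rw [one_mul, norm_iteratedFDeriv_fderiv]
    _ ≤ N := h.2 p hp (k + 1) (by omega)

lemma SquareBound.pdx {n : ℕ} {N : ℝ} {f : ℝ × ℝ → ℝ} (h : SquareBound (n + 1) N f) :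
    SquareBound n N (pdx f) := by
  have e : _root_.pdx f = fun p => fderiv ℝ f p (1, 0) :=
    funext fun p => (hasDerivAt_slice_fst h.differentiable p).deriv
  rw [e]
  exact h.fderiv_apply (by simp [Prod.norm_def])

lemma SquareBound.pdy {n : ℕ} {N : ℝ} {f : ℝ × ℝ → ℝ} (h : SquareBound (n + 1) N f) :
    SquareBound n N (pdy f) := by
  have e : _root_.pdy f = fun p => fderiv ℝ f p (0, 1) :=
    funext fun p => (hasDerivAt_slice_snd h.differentiable p).deriv
  rw [e]
  exact h.fderiv_apply (by simp [Prod.norm_def])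

lemma SquareBound.hasDerivAt_fst {n : ℕ} {N : ℝ} {f : ℝ × ℝ → ℝ} (h : SquareBound (n + 1) N f)
    (s t : ℝ) : HasDerivAt (fun r => f (r, t)) (_root_.pdx f (s, t)) s :=
  (hasDerivAt_slice_fst h.differentiable (s, t)).differentiableAt.hasDerivAt

lemma SquareBound.hasDerivAt_snd {n : ℕ} {N : ℝ} {f : ℝ × ℝ → ℝ} (h : SquareBound (n + 1) N f)
    (s t : ℝ) : HasDerivAt (fun r => f (s, r)) (_root_.pdy f (s, t)) t :=
  (hasDerivAt_slice_snd h.differentiable (s, t)).differentiableAt.hasDerivAt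

lemma SquareBound.abs_le {n : ℕ} {N : ℝ} {f : ℝ × ℝ → ℝ} (h : SquareBound n N f) {s t : ℝ}
    (hs : s ∈ Set.Icc (0 : ℝ) 1) (ht : t ∈ Set.Icc (0 : ℝ) 1) : |f (s, t)| ≤ N := by
  have := h.2 (s, t) ⟨⟨hs.1, ht.1⟩, ⟨hs.2, ht.2⟩⟩ 0 (Nat.zero_le n)
  rwa [norm_iteratedFDeriv_zero, Real.norm_eq_abs] at this

lemma SquareBound.derivBounds_fst {N : ℝ} {f : ℝ × ℝ → ℝ} (h : SquareBound 3 N f) {t : ℝ}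
    (ht : t ∈ Set.Icc (0 : ℝ) 1) :
    DerivBounds N (fun s => f (s, t)) (fun s => _root_.pdx f (s, t))
      (fun s => _root_.pdx (_root_.pdx f) (s, t))
      (fun s => _root_.pdx (_root_.pdx (_root_.pdx f)) (s, t)) :=
  ⟨fun s => h.hasDerivAt_fst s t, fun s => h.pdx.hasDerivAt_fst s t,
    fun s => h.pdx.pdx.hasDerivAt_fst s t, fun _ hs => h.pdx.abs_le hs ht,
    fun _ hs => h.pdx.pdx.abs_le hs ht, fun _ hs => h.pdx.pdx.pdx.abs_le hs ht⟩

lemma SquareBound.derivBounds_snd {N : ℝ} {f : ℝ × ℝ → ℝ} (h : SquareBound 3 N f) {s : ℝ}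
    (hs : s ∈ Set.Icc (0 : ℝ) 1) :
    DerivBounds N (fun t => f (s, t)) (fun t => _root_.pdy f (s, t))
      (fun t => _root_.pdy (_root_.pdy f) (s, t))
      (fun t => _root_.pdy (_root_.pdy (_root_.pdy f)) (s, t)) :=
  ⟨fun t => h.hasDerivAt_snd s t, fun t => h.pdy.hasDerivAt_snd s t,
    fun t => h.pdy.pdy.hasDerivAt_snd s t, fun _ ht => h.pdy.abs_le hs ht,
    fun _ ht => h.pdy.pdy.abs_le hs ht, fun _ ht => h.pdy.pdy.pdy.abs_le hs ht⟩

lemma SquareBound.abs_sub_fst_le {n : ℕ} {N : ℝ} {f : ℝ × ℝ → ℝ} (h : SquareBound (n + 1) N f)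
    {a b t : ℝ} (ha : a ∈ Set.Icc (0 : ℝ) 1) (hb : b ∈ Set.Icc (0 : ℝ) 1)
    (ht : t ∈ Set.Icc (0 : ℝ) 1) : |f (b, t) - f (a, t)| ≤ N * |b - a| :=
  abs_sub_le_of_deriv_uIcc (fun s => h.hasDerivAt_fst s t)
    fun _ hs => h.pdx.abs_le (uIcc_subset_unit ha hb hs) ht

lemma SquareBound.abs_sub_snd_le {n : ℕ} {N : ℝ} {f : ℝ × ℝ → ℝ} (h : SquareBound (n + 1) N f)
    {a b s : ℝ} (ha : a ∈ Set.Icc (0 : ℝ) 1) (hb : b ∈ Set.Icc (0 : ℝ) 1)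
    (hs : s ∈ Set.Icc (0 : ℝ) 1) : |f (s, b) - f (s, a)| ≤ N * |b - a| :=
  abs_sub_le_of_deriv_uIcc (fun t => h.hasDerivAt_snd s t)
    fun _ ht => h.pdy.abs_le hs (uIcc_subset_unit ha hb ht)

lemma ContDiff.squareBound_norm3 {f : ℝ × ℝ → ℝ} (hf : ContDiff ℝ 3 f) :
    SquareBound 3 (norm3 f) f := by
  refine ⟨by exact_mod_cast hf, fun p hp k hk => ?_⟩
  have hbdd : BddAbove (Set.range fun q : Set.Icc ((0 : ℝ), (0 : ℝ)) ((1 : ℝ), (1 : ℝ)) =>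
      ⨆ k : Fin 4, ‖iteratedFDeriv ℝ (k : ℕ) f (q : ℝ × ℝ)‖) := by
    have hb : ∀ k : Fin 4, ∃ B, ∀ q ∈ Set.Icc ((0 : ℝ), (0 : ℝ)) ((1 : ℝ), (1 : ℝ)),
        ‖iteratedFDeriv ℝ (k : ℕ) f q‖ ≤ B := fun k =>
      isCompact_Icc.exists_bound_of_continuousOn
        (hf.continuous_iteratedFDeriv (by exact_mod_cast Nat.lt_succ_iff.1 k.2)).continuousOn
    choose B hB using hb
    refine ⟨⨆ k, B k, ?_⟩
    rintro _ ⟨q, rfl⟩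
    exact ciSup_mono (Set.finite_range B).bddAbove fun k => hB k q q.2
  exact (le_ciSup (f := fun k : Fin 4 => ‖iteratedFDeriv ℝ (k : ℕ) f p‖)
    (Set.finite_range _).bddAbove ⟨k, Nat.lt_succ_of_le hk⟩).trans
    (le_ciSup hbdd ⟨p, hp⟩)

namespace IsGrid

variable {x : ℕ → ℝ} {n : ℕ}

lemma hMid_pos (hx : IsGrid x n) {i : ℕ} (hi : i < n) : 0 < hMid x i :=
  sub_pos.2 (hx.2.2 i hi)

lemma mem_unit (hx : IsGrid x n) {i : ℕ} (hi : i ≤ n) : x i ∈ Set.Icc (0 : ℝ) 1 := by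
  constructor
  · induction i with
    | zero => exact hx.1.ge
    | succ k ih => exact (ih (by omega)).trans (hx.2.2 k (by omega)).le
  · induction hi using Nat.decreasingInduction with
    | self => exact hx.2.1.le
    | of_succ k hk ih => exact (hx.2.2 k hk).le.trans ih

lemma midpt_mem_Ioo (hx : IsGrid x n) {i : ℕ} (hi : i < n) :
    midpt x i ∈ Set.Ioo (0 : ℝ) 1 := by
  have h1 := (hx.mem_unit hi.le).1
  have h2 := (hx.mem_unit (Nat.succ_le_of_lt hi)).2
  have h3 := hx.2.2 i hi
  simp only [midpt, Set.mem_Ioo]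
  constructor <;> linarith

lemma midpt_mem (hx : IsGrid x n) {i : ℕ} (hi : i < n) : midpt x i ∈ Set.Icc (0 : ℝ) 1 :=
  Set.Ioo_subset_Icc_self (hx.midpt_mem_Ioo hi)

lemma hMid_le_hmax {i : ℕ} (hi : i < n) : hMid x i ≤ hmax x n :=
  le_ciSup (f := fun i : Fin n => hMid x i) (Set.finite_range _).bddAbove ⟨i, hi⟩

lemma hNode_interior {i : ℕ} (h1 : 1 ≤ i) (hi : i < n) :
    hNode x n i = midpt x i - midpt x (i - 1) := by
  rw [hNode, if_neg (by omega), if_neg hi.ne]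

lemma hNode_interior_eq {i : ℕ} (h1 : 1 ≤ i) (hi : i < n) :
    hNode x n i = hMid x (i - 1) / 2 + hMid x i / 2 := by
  rw [hNode_interior h1 hi]
  obtain ⟨k, rfl⟩ : ∃ k, i = k + 1 := ⟨i - 1, by omega⟩
  simp only [midpt, hMid, Nat.add_sub_cancel]
  ring

lemma hNode_pos (hx : IsGrid x n) (hn : 0 < n) {i : ℕ} (hi : i ≤ n) : 0 < hNode x n i := by
  rcases Nat.eq_zero_or_pos i with rfl | h1
  · simpa [hNode] using hx.hMid_pos hn
  rcases hi.eq_or_lt with rfl | h2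
  · simpa [hNode, hn.ne'] using hx.hMid_pos (show i - 1 < i by omega)
  · rw [hNode_interior_eq h1 h2]
    have := hx.hMid_pos h2
    have := hx.hMid_pos (show i - 1 < n by omega)
    positivity

lemma sum_hMid (hx : IsGrid x n) : ∑ i ∈ range n, hMid x i = 1 := by
  simp only [hMid]
  rw [sum_range_sub, hx.1, hx.2.1, sub_zero]

lemma sum_hNode (hx : IsGrid x n) (hn : 0 < n) : ∑ i ∈ range (n + 1), hNode x n i = 1 := by
  obtain ⟨m, rfl⟩ : ∃ m, n = m + 1 := ⟨n - 1, by omega⟩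
  rw [sum_range_succ, sum_range_succ']
  have e : ∀ i ∈ range m, hNode x (m + 1) (i + 1) = midpt x (i + 1) - midpt x i := by
    intro i hi
    rw [hNode_interior (by omega) (by simpa using hi), Nat.add_sub_cancel]
  rw [sum_congr rfl e, sum_range_sub]
  have h1 := hx.1
  have h2 := hx.2.1
  simp [hNode, midpt, hMid] at h1 h2 ⊢
  rw [h1, h2]
  ring

lemma sum_hNode_interior_le (hx : IsGrid x n) (hn : 0 < n) :
    ∑ i ∈ Ico 1 n, hNode x n i ≤ 1 := by
  rw [← hx.sum_hNode hn]
  refine sum_le_sum_of_subset_of_nonneg (fun i hi => ?_) fun i hi _ => ?_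
  · simp at hi ⊢; omega
  · exact (hx.hNode_pos hn (by simpa [Nat.lt_succ_iff] using hi)).le

end IsGrid

/-- The one-dimensional interpolant `g - (h_{i+1/2}²/8) g''` at the midpoint `x_{i+1/2}`. -/
def correctedMid (x : ℕ → ℝ) (g g2 : ℝ → ℝ) (i : ℕ) : ℝ :=
  g (midpt x i) - hMid x i ^ 2 / 8 * g2 (midpt x i)

namespace DerivBounds

variable {N : ℝ} {g g1 g2 g3 : ℝ → ℝ} {x : ℕ → ℝ} {n : ℕ}

lemma abs_correctedMid_sub_left (h : DerivBounds N g g1 g2 g3) (hx : IsGrid x n) {i : ℕ}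
    (hi : i < n) :
    |correctedMid x g g2 i - g (x i) - g1 (x i) * (hMid x i / 2)|
      ≤ N * hmax x n ^ 2 * (hMid x i / 2) := by
  have e := h.abs_corrected_sub_le (hx.mem_unit hi.le) (hx.midpt_mem hi)
  have e0 : midpt x i - x i = hMid x i / 2 := by simp only [midpt, hMid]; ring
  have hp := hx.hMid_pos hi
  have hN := h.nonneg
  have hle : hMid x i ≤ hmax x n := IsGrid.hMid_le_hmax hi
  rw [e0, abs_of_pos (half_pos hp)] at e
  calc _ = |g (midpt x i) - (hMid x i / 2) ^ 2 / 2 * g2 (midpt x i) - g (x i)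
            - g1 (x i) * (hMid x i / 2)| := by congr 1; rw [correctedMid]; ring
    _ ≤ 2 * N * (hMid x i / 2) ^ 3 := e
    _ = N * hMid x i ^ 2 * (hMid x i / 2) / 2 := by ring
    _ ≤ N * hMid x i ^ 2 * (hMid x i / 2) := half_le_self (by positivity)
    _ ≤ _ := by gcongr

lemma abs_correctedMid_sub_right (h : DerivBounds N g g1 g2 g3) (hx : IsGrid x n) {i : ℕ}
    (hi : i < n) :
    |g (x (i + 1)) - correctedMid x g g2 i - g1 (x (i + 1)) * (hMid x i / 2)|
      ≤ N * hmax x n ^ 2 * (hMid x i / 2) := by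
  have e := h.abs_corrected_sub_le (hx.mem_unit (Nat.succ_le_of_lt hi)) (hx.midpt_mem hi)
  have e0 : midpt x i - x (i + 1) = -(hMid x i / 2) := by simp only [midpt, hMid]; ring
  have hp := hx.hMid_pos hi
  have hN := h.nonneg
  have hle : hMid x i ≤ hmax x n := IsGrid.hMid_le_hmax hi
  rw [e0, abs_neg, abs_of_pos (half_pos hp), ← abs_neg] at e
  calc _ = |-(g (midpt x i) - (-(hMid x i / 2)) ^ 2 / 2 * g2 (midpt x i) - g (x (i + 1))
            - g1 (x (i + 1)) * -(hMid x i / 2))| := by congr 1; rw [correctedMid]; ring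
    _ ≤ 2 * N * (hMid x i / 2) ^ 3 := e
    _ = N * hMid x i ^ 2 * (hMid x i / 2) / 2 := by ring
    _ ≤ N * hMid x i ^ 2 * (hMid x i / 2) := half_le_self (by positivity)
    _ ≤ _ := by gcongr

lemma abs_correctedMid_diff (h : DerivBounds N g g1 g2 g3) (hx : IsGrid x n) {i : ℕ}
    (h1 : 1 ≤ i) (hi : i < n) :
    |(correctedMid x g g2 i - correctedMid x g g2 (i - 1)) / hNode x n i - g1 (x i)|
      ≤ N * hmax x n ^ 2 := by
  obtain ⟨k, rfl⟩ : ∃ k, i = k + 1 := ⟨i - 1, by omega⟩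
  have hp := hx.hNode_pos (by omega) hi.le
  have e1 := h.abs_correctedMid_sub_left hx hi
  have e2 := h.abs_correctedMid_sub_right hx (show k < n by omega)
  rw [div_sub' hp.ne', abs_div, abs_of_pos hp, div_le_iff₀ hp,
    IsGrid.hNode_interior_eq h1 hi, Nat.add_sub_cancel]
  refine (le_of_eq ?_).trans ((abs_add_le _ _).trans ((add_le_add e1 e2).trans (le_of_eq ?_)))
  · congr 1; ring
  · ring

lemma abs_DyE_correctedMid (h : DerivBounds N g g1 g2 g3) (hx : IsGrid x n) (hn : 0 < n)
    (h0 : g 0 = 0) (hn1 : g 1 = 0) {w : ℕ → ℕ → ℝ} {i j : ℕ}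
    (hw : ∀ k < n, w i k = correctedMid x g g2 k) (hj : j ≤ n) :
    |DyE x n w 0 0 i j - g1 (x j)| ≤ N * hmax x n ^ 2 := by
  have hp := hx.hNode_pos hn hj
  unfold DyE
  split_ifs with hj0 hjn
  · subst hj0
    have e := h.abs_correctedMid_sub_left hx hn
    rw [hx.1, h0] at e
    have e' : hNode x n 0 = hMid x 0 / 2 := by simp [hNode]
    rw [div_sub' hp.ne', abs_div, abs_of_pos hp, div_le_iff₀ hp, e', hw 0 hn, hx.1]
    refine (le_of_eq ?_).trans e
    congr 1; simp; ring
  · subst hjn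
    obtain ⟨k, rfl⟩ : ∃ k, j = k + 1 := ⟨j - 1, by omega⟩
    have e := h.abs_correctedMid_sub_right hx (Nat.lt_succ_self k)
    rw [hx.2.1, hn1] at e
    have e' : hNode x (k + 1) (k + 1) = hMid x k / 2 := by simp [hNode]
    rw [div_sub' hp.ne', abs_div, abs_of_pos hp, div_le_iff₀ hp, e', Nat.add_sub_cancel,
      hw k (Nat.lt_succ_self k), hx.2.1]
    refine (le_of_eq ?_).trans e
    congr 1; simp; ring
  · rw [hw j (by omega), hw (j - 1) (by omega)]
    exact h.abs_correctedMid_diff hx (by omega) (by omega)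

lemma abs_node_diff (h : DerivBounds N g g1 g2 g3) (hx : IsGrid x n) {i : ℕ} (hi : i < n) :
    |(g (x (i + 1)) - g (x i)) / hMid x i - g1 (midpt x i)| ≤ N * hmax x n ^ 2 := by
  have hp := hx.hMid_pos hi
  refine (h.abs_centered_sub_le (hx.mem_unit hi.le) (hx.mem_unit (Nat.succ_le_of_lt hi))
    (hx.2.2 i hi)).trans ?_
  have hN := h.nonneg
  have hle : hMid x i ≤ hmax x n := IsGrid.hMid_le_hmax hi
  change N * hMid x i ^ 2 ≤ _
  gcongr

end DerivBounds

lemma abs_sq_div_eight_mul_le {a H b N : ℝ} (ha : 0 < a) (haH : a ≤ H) (hb : |b| ≤ N) :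
    |a ^ 2 / 8 * b| ≤ N * H ^ 2 := by
  have hN : 0 ≤ N := (abs_nonneg b).trans hb
  rw [abs_mul, abs_of_nonneg (by positivity : 0 ≤ a ^ 2 / 8)]
  calc a ^ 2 / 8 * |b| ≤ a ^ 2 / 8 * N := by gcongr
    _ = N * a ^ 2 / 8 := by ring
    _ ≤ N * a ^ 2 := div_le_self (by positivity) (by norm_num)
    _ ≤ _ := by gcongr

lemma abs_sq_div_eight_mul_div_le {a H d b N : ℝ} (ha : 0 < a) (haH : a ≤ H) (hb : 0 < b)
    (hd : |d| ≤ N * |b|) : |a ^ 2 / 8 * (d / b)| ≤ N * H ^ 2 :=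
  abs_sq_div_eight_mul_le ha haH (by rwa [abs_div, div_le_iff₀ (abs_pos.2 hb.ne')])

lemma abs_edge_diff_fst {N : ℝ} {u : ℝ × ℝ → ℝ} (hu : SquareBound 3 N u) {x y : ℕ → ℝ}
    {nx ny : ℕ} (hx : IsGrid x nx) (hy : IsGrid y ny) {i j : ℕ} (hi : i < nx) (hj : j < ny) :
    |(correctedMid y (fun t => u (x (i + 1), t)) (fun t => pdy (pdy u) (x (i + 1), t)) j
        - correctedMid y (fun t => u (x i, t)) (fun t => pdy (pdy u) (x i, t)) j) / hMid x i
      - pdx u (midpt x i, midpt y j)| ≤ N * (hmax x nx ^ 2 + hmax y ny ^ 2) := by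
  have hp := hx.hMid_pos hi
  have hq := hy.hMid_pos hj
  have hle : hMid y j ≤ hmax y ny := IsGrid.hMid_le_hmax hj
  have hD := hu.derivBounds_fst (hy.midpt_mem hj)
  have e1 := hD.abs_node_diff hx hi
  have e2 := hu.pdy.pdy.abs_sub_fst_le (hx.mem_unit hi.le) (hx.mem_unit (Nat.succ_le_of_lt hi))
    (hy.midpt_mem hj)
  have e3 : |hMid y j ^ 2 / 8 * ((pdy (pdy u) (x (i + 1), midpt y j)
      - pdy (pdy u) (x i, midpt y j)) / hMid x i)| ≤ N * hmax y ny ^ 2 :=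
    abs_sq_div_eight_mul_div_le hq hle hp e2
  rw [mul_add]
  refine (le_of_eq ?_).trans ((abs_sub _ _).trans (add_le_add e1 e3))
  congr 1
  simp only [correctedMid]
  field_simp
  ring

lemma abs_edge_diff_snd {N : ℝ} {u : ℝ × ℝ → ℝ} (hu : SquareBound 3 N u) {x y : ℕ → ℝ}
    {nx ny : ℕ} (hx : IsGrid x nx) (hy : IsGrid y ny) {i j : ℕ} (hi : i < nx) (hj : j < ny) :
    |(correctedMid x (fun s => u (s, y (j + 1))) (fun s => pdx (pdx u) (s, y (j + 1))) i
        - correctedMid x (fun s => u (s, y j)) (fun s => pdx (pdx u) (s, y j)) i) / hMid y j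
      - pdy u (midpt x i, midpt y j)| ≤ N * (hmax x nx ^ 2 + hmax y ny ^ 2) := by
  have hp := hy.hMid_pos hj
  have hq := hx.hMid_pos hi
  have hle : hMid x i ≤ hmax x nx := IsGrid.hMid_le_hmax hi
  have hD := hu.derivBounds_snd (hx.midpt_mem hi)
  have e1 := hD.abs_node_diff hy hj
  have e2 := hu.pdx.pdx.abs_sub_snd_le (hy.mem_unit hj.le) (hy.mem_unit (Nat.succ_le_of_lt hj))
    (hx.midpt_mem hi)
  have e3 : |hMid x i ^ 2 / 8 * ((pdx (pdx u) (midpt x i, y (j + 1))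
      - pdx (pdx u) (midpt x i, y j)) / hMid y j)| ≤ N * hmax x nx ^ 2 :=
    abs_sq_div_eight_mul_div_le hq hle hp e2
  rw [mul_add, add_comm (N * hmax x nx ^ 2)]
  refine (le_of_eq ?_).trans ((abs_sub _ _).trans (add_le_add e1 e3))
  congr 1
  simp only [correctedMid]
  field_simp
  ring

lemma abs_sigmaTilde_sub {N : ℝ} {s : ℝ × ℝ → ℝ} (hs : SquareBound 3 N s) {x y : ℕ → ℝ}
    {nx ny : ℕ} (hx : IsGrid x nx) (hy : IsGrid y ny) {i j : ℕ} (hi : i < nx) (hj : j < ny) :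
    |sigmaTilde x y s i j - s (midpt x i, midpt y j)|
      ≤ N * (hmax x nx ^ 2 + hmax y ny ^ 2) := by
  have hp := hx.hMid_pos hi
  have hq := hy.hMid_pos hj
  have hxle : hMid x i ≤ hmax x nx := IsGrid.hMid_le_hmax hi
  have hyle : hMid y j ≤ hmax y ny := IsGrid.hMid_le_hmax hj
  have b1 := hs.pdx.pdx.abs_le (hx.midpt_mem hi) (hy.midpt_mem hj)
  have b2 := hs.pdy.pdy.abs_le (hx.midpt_mem hi) (hy.midpt_mem hj)
  rw [mul_add, abs_sub_comm]
  refine (le_of_eq ?_).trans ((abs_add_le _ _).trans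
    (add_le_add (abs_sq_div_eight_mul_le hp hxle b1) (abs_sq_div_eight_mul_le hq hyle b2)))
  congr 1
  rw [sigmaTilde]
  ring

lemma abs_sigmaTilde_diff_fst {N : ℝ} {s : ℝ × ℝ → ℝ} (hs : SquareBound 3 N s) {x y : ℕ → ℝ}
    {nx ny : ℕ} (hx : IsGrid x nx) (hy : IsGrid y ny) {i j : ℕ} (h1 : 1 ≤ i) (hi : i < nx)
    (hj : j < ny) :
    |(sigmaTilde x y s i j - sigmaTilde x y s (i - 1) j) / hNode x nx i
      - pdx s (x i, midpt y j)| ≤ N * (hmax x nx ^ 2 + hmax y ny ^ 2) := by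
  have hp := hx.hNode_pos (by omega) hi.le
  have hq := hy.hMid_pos hj
  have hle : hMid y j ≤ hmax y ny := IsGrid.hMid_le_hmax hj
  have hD := hs.derivBounds_fst (hy.midpt_mem hj)
  have e1 := hD.abs_correctedMid_diff hx h1 hi
  have e2 := hs.pdy.pdy.abs_sub_fst_le (hx.midpt_mem (show i - 1 < nx by omega))
    (hx.midpt_mem hi) (hy.midpt_mem hj)
  have e3 : |hMid y j ^ 2 / 8 * ((pdy (pdy s) (midpt x i, midpt y j)
      - pdy (pdy s) (midpt x (i - 1), midpt y j)) / hNode x nx i)| ≤ N * hmax y ny ^ 2 :=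
    abs_sq_div_eight_mul_div_le hq hle hp (by rwa [IsGrid.hNode_interior h1 hi])
  rw [mul_add]
  refine (le_of_eq ?_).trans ((abs_sub _ _).trans (add_le_add e1 e3))
  congr 1
  simp only [correctedMid, sigmaTilde]
  field_simp
  ring

lemma abs_sigmaTilde_diff_snd {N : ℝ} {s : ℝ × ℝ → ℝ} (hs : SquareBound 3 N s) {x y : ℕ → ℝ}
    {nx ny : ℕ} (hx : IsGrid x nx) (hy : IsGrid y ny) {i j : ℕ} (h1 : 1 ≤ j) (hi : i < nx)
    (hj : j < ny) :
    |(sigmaTilde x y s i j - sigmaTilde x y s i (j - 1)) / hNode y ny j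
      - pdy s (midpt x i, y j)| ≤ N * (hmax x nx ^ 2 + hmax y ny ^ 2) := by
  have hp := hy.hNode_pos (by omega) hj.le
  have hq := hx.hMid_pos hi
  have hle : hMid x i ≤ hmax x nx := IsGrid.hMid_le_hmax hi
  have hD := hs.derivBounds_snd (hx.midpt_mem hi)
  have e1 := hD.abs_correctedMid_diff hy h1 hj
  have e2 := hs.pdx.pdx.abs_sub_snd_le (hy.midpt_mem (show j - 1 < ny by omega))
    (hy.midpt_mem hj) (hx.midpt_mem hi)
  have e3 : |hMid x i ^ 2 / 8 * ((pdx (pdx s) (midpt x i, midpt y j)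
      - pdx (pdx s) (midpt x i, midpt y (j - 1))) / hNode y ny j)| ≤ N * hmax x nx ^ 2 :=
    abs_sq_div_eight_mul_div_le hq hle hp (by rwa [IsGrid.hNode_interior h1 hj])
  rw [mul_add, add_comm (N * hmax x nx ^ 2)]
  refine (le_of_eq ?_).trans ((abs_sub _ _).trans (add_le_add e1 e3))
  congr 1
  simp only [correctedMid, sigmaTilde]
  field_simp
  ring

/-- The weighted double sum underlying all the discrete inner products. -/
def weightedSum (s t : Finset ℕ) (a b : ℕ → ℝ) (F : ℕ → ℕ → ℝ) : ℝ :=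
  ∑ i ∈ s, ∑ j ∈ t, a i * b j * F i j

section WeightedSum

variable {s t : Finset ℕ} {a b : ℕ → ℝ}

lemma weightedSum_add (F G : ℕ → ℕ → ℝ) :
    weightedSum s t a b (fun i j => F i j + G i j)
      = weightedSum s t a b F + weightedSum s t a b G := by
  simp only [weightedSum, mul_add, sum_add_distrib]

lemma weightedSum_const_mul (c : ℝ) (F : ℕ → ℕ → ℝ) :
    weightedSum s t a b (fun i j => c * F i j) = c * weightedSum s t a b F := by
  simp only [weightedSum, mul_sum]
  exact sum_congr rfl fun i _ => sum_congr rfl fun j _ => by ring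

lemma weightedSum_const (c : ℝ) :
    weightedSum s t a b (fun _ _ => c) = (∑ i ∈ s, a i) * (∑ j ∈ t, b j) * c := by
  rw [weightedSum, sum_mul_sum, sum_mul]
  exact sum_congr rfl fun i _ => by rw [sum_mul]

lemma weightedSum_mono (ha : ∀ i ∈ s, 0 ≤ a i) (hb : ∀ j ∈ t, 0 ≤ b j) {F G : ℕ → ℕ → ℝ}
    (h : ∀ i ∈ s, ∀ j ∈ t, F i j ≤ G i j) : weightedSum s t a b F ≤ weightedSum s t a b G :=
  sum_le_sum fun i hi => sum_le_sum fun j hj =>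
    mul_le_mul_of_nonneg_left (h i hi j hj) (mul_nonneg (ha i hi) (hb j hj))

lemma weightedSum_swap (F : ℕ → ℕ → ℝ) :
    weightedSum s t a b F = weightedSum t s b a (fun j i => F i j) := by
  rw [weightedSum, sum_comm]
  exact sum_congr rfl fun j _ => sum_congr rfl fun i _ => by ring

end WeightedSum

lemma ipM_eq_weightedSum (x y : ℕ → ℝ) (nx ny : ℕ) (φ θ : ℕ → ℕ → ℝ) :
    ipM x y nx ny φ θ
      = weightedSum (range nx) (range ny) (hMid x) (hMid y) (fun i j => φ i j * θ i j) := by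
  simp only [ipM, weightedSum, mul_assoc]

lemma sum_mul_backward_diff (v T : ℕ → ℝ) {n : ℕ} (hn : 0 < n) (h0 : v 0 = 0) (h1 : v n = 0) :
    ∑ i ∈ Ico 1 n, v i * (T i - T (i - 1)) = -∑ i ∈ range n, T i * (v (i + 1) - v i) := by
  obtain ⟨m, rfl⟩ : ∃ m, n = m + 1 := ⟨n - 1, by omega⟩
  have key : ∀ m, ∑ i ∈ Ico 1 (m + 1), v i * (T i - T (i - 1))
      = -∑ i ∈ range (m + 1), T i * (v (i + 1) - v i) + T m * v (m + 1) - T 0 * v 0 := by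
    intro m
    induction m with
    | zero => simp; ring
    | succ k ih =>
      rw [sum_Ico_succ_top (by omega), ih, sum_range_succ _ (k + 1), Nat.add_sub_cancel]
      ring
  rw [key, h0, h1]
  ring

lemma sum_mul_DyE {x : ℕ → ℝ} {n : ℕ} (hx : IsGrid x n) (hn : 0 < n) (Z : ℕ → ℝ)
    (v : ℕ → ℕ → ℝ) (i : ℕ) :
    ∑ j ∈ range (n + 1), hNode x n j * (Z j * DyE x n v 0 0 i j)
      = -∑ j ∈ range n, v i j * (Z (j + 1) - Z j) := by
  obtain ⟨m, rfl⟩ : ∃ m, n = m + 1 := ⟨n - 1, by omega⟩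
  have h0 : hNode x (m + 1) 0 ≠ 0 := (hx.hNode_pos hn (by omega)).ne'
  have h1 : hNode x (m + 1) (m + 1) ≠ 0 := (hx.hNode_pos hn le_rfl).ne'
  have e : ∀ j ∈ range m, hNode x (m + 1) (j + 1) * (Z (j + 1) * DyE x (m + 1) v 0 0 i (j + 1))
      = Z (j + 1) * (v i (j + 1) - v i j) := by
    intro j hj
    have hj' : j < m := by simpa using hj
    have h : hNode x (m + 1) (j + 1) ≠ 0 := (hx.hNode_pos hn (by omega)).ne'
    rw [DyE, if_neg (by omega), if_neg (by omega), Nat.add_sub_cancel]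
    field_simp
  have e0 : hNode x (m + 1) 0 * (Z 0 * DyE x (m + 1) v 0 0 i 0) = Z 0 * v i 0 := by
    rw [DyE, if_pos rfl]
    field_simp
    simp
  have e1 : hNode x (m + 1) (m + 1) * (Z (m + 1) * DyE x (m + 1) v 0 0 i (m + 1))
      = -(Z (m + 1) * v i m) := by
    rw [DyE, if_neg (by omega), if_pos rfl, Nat.add_sub_cancel]
    field_simp
    simp
  have key : ∀ m, ∑ j ∈ range m, Z (j + 1) * (v i (j + 1) - v i j) + Z 0 * v i 0
      + -(Z (m + 1) * v i m) = -∑ j ∈ range (m + 1), v i j * (Z (j + 1) - Z j) := by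
    intro m
    induction m with
    | zero => simp; ring
    | succ k ih =>
      rw [sum_range_succ, sum_range_succ _ (k + 1)]
      linarith
  rw [sum_range_succ, sum_range_succ', sum_congr rfl e, e0, e1, key]

section ByParts

variable {x y : ℕ → ℝ} {nx ny : ℕ}

/-- Summation by parts for the first momentum balance. -/
lemma momentum_fst_by_parts (hx : IsGrid x nx) (hy : IsGrid y ny) (hnx : 0 < nx) (hny : 0 < ny)
    {e T S : ℕ → ℕ → ℝ} (he : ∀ j < ny, e 0 j = 0 ∧ e nx j = 0) :
    weightedSum (Ico 1 nx) (range ny) (hNode x nx) (hMid y)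
        (fun i j => ((T i j - T (i - 1) j) / hNode x nx i
          + (S i (j + 1) - S i j) / hMid y j) * e i j)
      + weightedSum (range nx) (range ny) (hMid x) (hMid y)
        (fun i j => T i j * ((e (i + 1) j - e i j) / hMid x i))
      + weightedSum (range (nx + 1)) (range (ny + 1)) (hNode x nx) (hNode y ny)
        (fun i j => S i j * DyE y ny e 0 0 i j) = 0 := by
  have e1 : weightedSum (Ico 1 nx) (range ny) (hNode x nx) (hMid y)
        (fun i j => ((T i j - T (i - 1) j) / hNode x nx i
          + (S i (j + 1) - S i j) / hMid y j) * e i j)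
      = ∑ j ∈ range ny, hMid y j * ∑ i ∈ Ico 1 nx, e i j * (T i j - T (i - 1) j)
        + ∑ i ∈ Ico 1 nx, hNode x nx i * ∑ j ∈ range ny, e i j * (S i (j + 1) - S i j) := by
    simp only [mul_sum]
    rw [sum_comm, ← sum_add_distrib, weightedSum]
    refine sum_congr rfl fun i hi => ?_
    rw [← sum_add_distrib]
    refine sum_congr rfl fun j hj => ?_
    have h1 := (hx.hNode_pos hnx (mem_Ico.1 hi).2.le).ne'
    have h2 := (hy.hMid_pos (mem_range.1 hj)).ne'
    field_simp
  have e2 : weightedSum (range nx) (range ny) (hMid x) (hMid y)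
        (fun i j => T i j * ((e (i + 1) j - e i j) / hMid x i))
      = ∑ j ∈ range ny, hMid y j * ∑ i ∈ range nx, T i j * (e (i + 1) j - e i j) := by
    simp only [mul_sum]
    rw [sum_comm, weightedSum]
    refine sum_congr rfl fun i hi => sum_congr rfl fun j hj => ?_
    have h1 := (hx.hMid_pos (mem_range.1 hi)).ne'
    field_simp
  have e3 : weightedSum (range (nx + 1)) (range (ny + 1)) (hNode x nx) (hNode y ny)
        (fun i j => S i j * DyE y ny e 0 0 i j)
      = ∑ i ∈ range (nx + 1), hNode x nx i * -∑ j ∈ range ny, e i j * (S i (j + 1) - S i j) := by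
    refine sum_congr rfl fun i _ => ?_
    rw [← sum_mul_DyE hy hny (S i) e i, mul_sum]
    exact sum_congr rfl fun j _ => by ring
  have e4 : ∑ i ∈ range (nx + 1), hNode x nx i * -∑ j ∈ range ny, e i j * (S i (j + 1) - S i j)
      = ∑ i ∈ Ico 1 nx, hNode x nx i * -∑ j ∈ range ny, e i j * (S i (j + 1) - S i j) := by
    refine (sum_subset (fun i hi => ?_) fun i hi hi' => ?_).symm
    · simp at hi ⊢; omega
    · have hi0 : i = 0 ∨ i = nx := by simp at hi hi'; omega
      have : ∀ j ∈ range ny, e i j * (S i (j + 1) - S i j) = 0 := by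
        intro j hj
        have := he j (mem_range.1 hj)
        rcases hi0 with rfl | rfl <;> simp [this]
      rw [sum_eq_zero this]
      simp
  have e5 : ∀ j ∈ range ny, hMid y j * ∑ i ∈ Ico 1 nx, e i j * (T i j - T (i - 1) j)
      = -(hMid y j * ∑ i ∈ range nx, T i j * (e (i + 1) j - e i j)) := by
    intro j hj
    have := he j (mem_range.1 hj)
    rw [sum_mul_backward_diff (fun i => e i j) (fun i => T i j) hnx this.1 this.2]
    ring
  rw [e1, e2, e3, e4, sum_congr rfl e5]
  simp only [mul_neg, sum_neg_distrib]
  ring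

/-- Summation by parts for the second momentum balance. -/
lemma momentum_snd_by_parts (hx : IsGrid x nx) (hy : IsGrid y ny) (hnx : 0 < nx) (hny : 0 < ny)
    {e T S : ℕ → ℕ → ℝ} (he : ∀ i < nx, e i 0 = 0 ∧ e i ny = 0) :
    weightedSum (range nx) (Ico 1 ny) (hMid x) (hNode y ny)
        (fun i j => ((S (i + 1) j - S i j) / hMid x i
          + (T i j - T i (j - 1)) / hNode y ny j) * e i j)
      + weightedSum (range nx) (range ny) (hMid x) (hMid y)
        (fun i j => T i j * ((e i (j + 1) - e i j) / hMid y j))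
      + weightedSum (range (nx + 1)) (range (ny + 1)) (hNode x nx) (hNode y ny)
        (fun i j => S i j * DxE x nx e 0 0 i j) = 0 := by
  rw [weightedSum_swap, weightedSum_swap (s := range nx) (t := range ny),
    weightedSum_swap (s := range (nx + 1))]
  have h := momentum_fst_by_parts hy hx hny hnx (e := fun j i => e i j) (T := fun j i => T i j)
    (S := fun j i => S i j) he
  simp only [add_comm (((T _ _ : ℝ) - _) / _)] at h
  exact h

/-- Discrete Poincaré inequality in the first variable. -/
lemma poincare_fst (hx : IsGrid x nx) (hy : IsGrid y ny) (hnx : 0 < nx)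
    {e : ℕ → ℕ → ℝ} (he : ∀ j < ny, e 0 j = 0) :
    weightedSum (Ico 1 nx) (range ny) (hNode x nx) (hMid y) (fun i j => e i j ^ 2)
      ≤ weightedSum (range nx) (range ny) (hMid x) (hMid y)
        (fun i j => ((e (i + 1) j - e i j) / hMid x i) ^ 2) := by
  rw [weightedSum_swap, weightedSum_swap (s := range nx)]
  refine sum_le_sum fun j hj => ?_
  have hq := (hy.hMid_pos (mem_range.1 hj)).le
  simp only [mul_assoc, ← mul_sum]
  refine mul_le_mul_of_nonneg_left ?_ hq
  set D := ∑ i ∈ range nx, hMid x i * ((e (i + 1) j - e i j) / hMid x i) ^ 2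
  have hterm : ∀ i ∈ range nx, 0 ≤ hMid x i * ((e (i + 1) j - e i j) / hMid x i) ^ 2 :=
    fun i hi => mul_nonneg (hx.hMid_pos (mem_range.1 hi)).le (sq_nonneg _)
  have hD : 0 ≤ D := sum_nonneg hterm
  have key : ∀ i ∈ Ico 1 nx, e i j ^ 2 ≤ D := by
    intro i hi
    have hi' := (mem_Ico.1 hi).2
    have hsub : range i ⊆ range nx := range_subset_range.2 hi'.le
    have hpos : ∀ k ∈ range i, 0 < hMid x k := fun k hk => hx.hMid_pos (mem_range.1 (hsub hk))
    have htel : e i j = ∑ k ∈ range i, (e (k + 1) j - e k j) := by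
      rw [sum_range_sub (fun k => e k j), he j (mem_range.1 hj), sub_zero]
    calc e i j ^ 2 = (∑ k ∈ range i, (e (k + 1) j - e k j)) ^ 2 := by rw [← htel]
      _ ≤ (∑ k ∈ range i, hMid x k)
          * ∑ k ∈ range i, hMid x k * ((e (k + 1) j - e k j) / hMid x k) ^ 2 := by
        refine sum_sq_le_sum_mul_sum_of_sq_le_mul _ (fun k hk => (hpos k hk).le)
          (fun k hk => hterm k (hsub hk)) fun k hk => le_of_eq ?_
        have := (hpos k hk).ne'
        field_simp
      _ ≤ 1 * D := by
        refine mul_le_mul ?_ (sum_le_sum_of_subset_of_nonneg hsub fun k hk _ => hterm k hk)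
          (sum_nonneg fun k hk => hterm k (hsub hk)) zero_le_one
        rw [← hx.sum_hMid]
        exact sum_le_sum_of_subset_of_nonneg hsub fun k hk _ => (hx.hMid_pos (mem_range.1 hk)).le
      _ = D := one_mul D
  calc ∑ i ∈ Ico 1 nx, hNode x nx i * e i j ^ 2 ≤ ∑ i ∈ Ico 1 nx, hNode x nx i * D :=
        sum_le_sum fun i hi => mul_le_mul_of_nonneg_left (key i hi)
          (hx.hNode_pos hnx (mem_Ico.1 hi).2.le).le
    _ = (∑ i ∈ Ico 1 nx, hNode x nx i) * D := by rw [sum_mul]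
    _ ≤ 1 * D := mul_le_mul_of_nonneg_right (hx.sum_hNode_interior_le hnx) hD
    _ = D := one_mul D

/-- Discrete Poincaré inequality in the second variable. -/
lemma poincare_snd (hx : IsGrid x nx) (hy : IsGrid y ny) (hny : 0 < ny)
    {e : ℕ → ℕ → ℝ} (he : ∀ i < nx, e i 0 = 0) :
    weightedSum (range nx) (Ico 1 ny) (hMid x) (hNode y ny) (fun i j => e i j ^ 2)
      ≤ weightedSum (range nx) (range ny) (hMid x) (hMid y)
        (fun i j => ((e i (j + 1) - e i j) / hMid y j) ^ 2) := by
  rw [weightedSum_swap, weightedSum_swap (s := range nx) (t := range ny)]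
  exact poincare_fst hy hx hny (e := fun j i => e i j) he

end ByParts

lemma compliance_energy {lam mu : ℝ} (hl : 0 < lam) (hm : 0 < mu) (p q : ℝ) :
    (p ^ 2 + q ^ 2) / (2 * (lam + mu))
      ≤ p * (1 / (2 * mu) * (p - lam / (2 * lam + 2 * mu) * (p + q)))
        + q * (1 / (2 * mu) * (q - lam / (2 * lam + 2 * mu) * (p + q))) := by
  have h1 : 0 ≤ lam / (4 * mu * (lam + mu)) * (p - q) ^ 2 := by positivity
  have h2 : p * (1 / (2 * mu) * (p - lam / (2 * lam + 2 * mu) * (p + q)))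
      + q * (1 / (2 * mu) * (q - lam / (2 * lam + 2 * mu) * (p + q)))
      - (p ^ 2 + q ^ 2) / (2 * (lam + mu)) = lam / (4 * mu * (lam + mu)) * (p - q) ^ 2 := by
    rw [show 2 * lam + 2 * mu = 2 * (lam + mu) by ring]
    have h3 : lam + mu ≠ 0 := by positivity
    field_simp
    ring
  linarith

lemma compliance_sq_le {lam mu : ℝ} (hl : 0 < lam) (hm : 0 < mu) (p q : ℝ) :
    (1 / (2 * mu) * (p - lam / (2 * lam + 2 * mu) * (p + q))) ^ 2
        + (1 / (2 * mu) * (q - lam / (2 * lam + 2 * mu) * (p + q))) ^ 2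
      ≤ (p ^ 2 + q ^ 2) / (2 * mu ^ 2) := by
  have hk0 : 0 ≤ lam / (2 * lam + 2 * mu) := by positivity
  have hk1 : lam / (2 * lam + 2 * mu) ≤ 1 := by rw [div_le_one (by positivity)]; linarith
  generalize lam / (2 * lam + 2 * mu) = k at hk0 hk1 ⊢
  calc _ = 1 / (4 * mu ^ 2) * ((p - k * (p + q)) ^ 2 + (q - k * (p + q)) ^ 2) := by ring
    _ ≤ 1 / (4 * mu ^ 2) * (2 * (p ^ 2 + q ^ 2)) := by
      refine mul_le_mul_of_nonneg_left ?_ (by positivity)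
      nlinarith [mul_nonneg (mul_nonneg hk0 (sub_nonneg.2 hk1)) (sq_nonneg (p + q)),
        sq_nonneg p, sq_nonneg q]
    _ = _ := by ring

lemma mul_le_young {L : ℝ} (hL : 0 < L) (a r : ℝ) :
    a * r ≤ a ^ 2 / (8 * L) + 2 * L * r ^ 2 := by
  have h1 : a ^ 2 / (8 * L) + 2 * L * r ^ 2 - a * r = (a - 4 * L * r) ^ 2 / (8 * L) := by
    field_simp
    ring
  have h2 : 0 ≤ (a - 4 * L * r) ^ 2 / (8 * L) := by positivity
  linarith

lemma energy_le_of_abs_sub_le {mu L p q A1 A2 d1 d2 ρ : ℝ} (hm : 0 < mu) (hmL : mu ≤ L)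
    (i1 : (p ^ 2 + q ^ 2) / (2 * L) ≤ p * A1 + q * A2)
    (i2 : A1 ^ 2 + A2 ^ 2 ≤ (p ^ 2 + q ^ 2) / (2 * mu ^ 2))
    (h1 : |A1 - d1| ≤ ρ) (h2 : |A2 - d2| ≤ ρ) :
    (1 / (4 * L)) * (p * p + q * q) + -(9 / 2 * L * ρ ^ 2)
      ≤ p * d1 + q * d2 + -(mu ^ 2 / (8 * L)) * (d1 ^ 2 + d2 ^ 2) := by
  have hL0 : 0 < L := hm.trans_le hmL
  have r1 := sq_le_sq' (abs_le.1 h1).1 (abs_le.1 h1).2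
  have r2 := sq_le_sq' (abs_le.1 h2).1 (abs_le.1 h2).2
  have y1 := mul_le_young hL0 p (A1 - d1)
  have y2 := mul_le_young hL0 q (A2 - d2)
  have hd : d1 ^ 2 + d2 ^ 2 ≤ (p ^ 2 + q ^ 2) / mu ^ 2 + 4 * ρ ^ 2 := by
    have e : (p ^ 2 + q ^ 2) / mu ^ 2 = 2 * ((p ^ 2 + q ^ 2) / (2 * mu ^ 2)) := by
      field_simp
    rw [e]
    nlinarith [sq_nonneg (2 * A1 - d1), sq_nonneg (2 * A2 - d2)]
  have hc : mu ^ 2 / (8 * L) * (d1 ^ 2 + d2 ^ 2)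
      ≤ (p ^ 2 + q ^ 2) / (8 * L) + L * ρ ^ 2 / 2 := by
    have hmuL : mu ^ 2 / (2 * L) ≤ L / 2 := by
      rw [div_le_iff₀ (by positivity)]
      nlinarith
    calc mu ^ 2 / (8 * L) * (d1 ^ 2 + d2 ^ 2)
        ≤ mu ^ 2 / (8 * L) * ((p ^ 2 + q ^ 2) / mu ^ 2 + 4 * ρ ^ 2) := by gcongr
      _ = (p ^ 2 + q ^ 2) / (8 * L) + mu ^ 2 / (2 * L) * ρ ^ 2 := by field_simp; ring
      _ ≤ (p ^ 2 + q ^ 2) / (8 * L) + L / 2 * ρ ^ 2 := by gcongr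
      _ = _ := by ring
  have hr1 := mul_le_mul_of_nonneg_left r1 (by positivity : 0 ≤ 2 * L)
  have hr2 := mul_le_mul_of_nonneg_left r2 (by positivity : 0 ≤ 2 * L)
  have e1 : (p ^ 2 + q ^ 2) / (2 * L) = 4 * ((p ^ 2 + q ^ 2) / (8 * L)) := by ring
  have e2 : 1 / (4 * L) * (p * p + q * q) = 2 * ((p ^ 2 + q ^ 2) / (8 * L)) := by ring
  have e3 : (p ^ 2 + q ^ 2) / (8 * L) = p ^ 2 / (8 * L) + q ^ 2 / (8 * L) := by ring
  rw [e2]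
  rw [e1] at i1
  linarith

/-- Coercivity of the compliance tensor, with the displacement gradient perturbed. -/
lemma compliance_coercive {lam mu p q d1 d2 ρ : ℝ} (hl : 0 < lam) (hm : 0 < mu)
    (h1 : |1 / (2 * mu) * (p - lam / (2 * lam + 2 * mu) * (p + q)) - d1| ≤ ρ)
    (h2 : |1 / (2 * mu) * (q - lam / (2 * lam + 2 * mu) * (p + q)) - d2| ≤ ρ) :
    (1 / (4 * (lam + mu))) * (p * p + q * q) + -(9 / 2 * (lam + mu) * ρ ^ 2)
      ≤ p * d1 + q * d2 + -(mu ^ 2 / (8 * (lam + mu))) * (d1 ^ 2 + d2 ^ 2) :=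
  energy_le_of_abs_sub_le hm (by linarith) (compliance_energy hl hm p q)
    (compliance_sq_le hl hm p q) h1 h2

lemma neg_sq_le_mul_of_abs_sub_le {mu L z d ρ : ℝ} (hm : 0 < mu) (hL : mu ≤ L)
    (h : |z - mu * d| ≤ mu * ρ) : -(L * ρ ^ 2 / 4) ≤ z * d := by
  have hz : (z - mu * d) * d ≥ -(mu * ρ * |d|) := by
    have := abs_mul (z - mu * d) d
    have h2 := neg_abs_le ((z - mu * d) * d)
    have h3 := mul_le_mul_of_nonneg_right h (abs_nonneg d)
    linarith
  have h4 : mu * (|d| ^ 2 - ρ * |d| + ρ ^ 2 / 4) = mu * (|d| - ρ / 2) ^ 2 := by ring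
  have h5 : 0 ≤ mu * (|d| - ρ / 2) ^ 2 := by positivity
  have h6 := sq_abs d
  nlinarith [mul_le_mul_of_nonneg_right hL (sq_nonneg ρ)]

lemma young_residual {mu L g e γ : ℝ} (hm : 0 < mu) (hL : 0 < L) (h : |g| ≤ γ) :
    -(2 * L / mu ^ 2 * γ ^ 2) + -(mu ^ 2 / (8 * L)) * e ^ 2 ≤ g * e := by
  have h1 : g ^ 2 ≤ γ ^ 2 := sq_le_sq' (abs_le.1 h).1 (abs_le.1 h).2
  have h2 : g * e + 2 * L / mu ^ 2 * g ^ 2 + mu ^ 2 / (8 * L) * e ^ 2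
      = (4 * L * g + mu ^ 2 * e) ^ 2 / (8 * L * mu ^ 2) := by
    field_simp
    ring
  have h3 : 0 ≤ (4 * L * g + mu ^ 2 * e) ^ 2 / (8 * L * mu ^ 2) := by positivity
  have h4 : 2 * L / mu ^ 2 * g ^ 2 ≤ 2 * L / mu ^ 2 * γ ^ 2 := by gcongr
  linarith

/-- Stability of the MAC-E scheme under perturbations of all its equations. -/
lemma mac_stability {lam mu ρ γ : ℝ} (hl : 0 < lam) (hm : 0 < mu) {x y : ℕ → ℝ} {nx ny : ℕ}
    (hx : IsGrid x nx) (hy : IsGrid y ny) (hnx : 0 < nx) (hny : 0 < ny)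
    {ex ey t11 t22 t12 : ℕ → ℕ → ℝ}
    (hex : ∀ j < ny, ex 0 j = 0 ∧ ex nx j = 0) (hey : ∀ i < nx, ey i 0 = 0 ∧ ey i ny = 0)
    (h11 : ∀ i < nx, ∀ j < ny,
      |1 / (2 * mu) * (t11 i j - lam / (2 * lam + 2 * mu) * (t11 i j + t22 i j))
        - (ex (i + 1) j - ex i j) / hMid x i| ≤ ρ)
    (h22 : ∀ i < nx, ∀ j < ny,
      |1 / (2 * mu) * (t22 i j - lam / (2 * lam + 2 * mu) * (t11 i j + t22 i j))
        - (ey i (j + 1) - ey i j) / hMid y j| ≤ ρ)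
    (h12 : ∀ i ≤ nx, ∀ j ≤ ny,
      |t12 i j - mu * (DyE y ny ex 0 0 i j + DxE x nx ey 0 0 i j)| ≤ mu * ρ)
    (hg1 : ∀ i, 1 ≤ i → i < nx → ∀ j < ny,
      |(t11 i j - t11 (i - 1) j) / hNode x nx i + (t12 i (j + 1) - t12 i j) / hMid y j| ≤ γ)
    (hg2 : ∀ i < nx, ∀ j, 1 ≤ j → j < ny →
      |(t12 (i + 1) j - t12 i j) / hMid x i + (t22 i j - t22 i (j - 1)) / hNode y ny j| ≤ γ) :
    ipM x y nx ny t11 t11 + ipM x y nx ny t22 t22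
      ≤ (lam + mu) ^ 2 * (19 * ρ ^ 2 + 16 / mu ^ 2 * γ ^ 2) := by
  obtain ⟨L, hL⟩ : ∃ L, L = lam + mu := ⟨_, rfl⟩
  have hL0 : 0 < L := by rw [hL]; positivity
  have hmx : ∀ i ∈ range nx, 0 ≤ hMid x i := fun i hi => (hx.hMid_pos (mem_range.1 hi)).le
  have hmy : ∀ j ∈ range ny, 0 ≤ hMid y j := fun j hj => (hy.hMid_pos (mem_range.1 hj)).le
  have hnnx : ∀ i ∈ range (nx + 1), 0 ≤ hNode x nx i :=
    fun i hi => (hx.hNode_pos hnx (mem_range_succ_iff.1 hi)).le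
  have hnny : ∀ j ∈ range (ny + 1), 0 ≤ hNode y ny j :=
    fun j hj => (hy.hNode_pos hny (mem_range_succ_iff.1 hj)).le
  have hnix : ∀ i ∈ Ico 1 nx, 0 ≤ hNode x nx i :=
    fun i hi => (hx.hNode_pos hnx (mem_Ico.1 hi).2.le).le
  have hniy : ∀ j ∈ Ico 1 ny, 0 ≤ hNode y ny j :=
    fun j hj => (hy.hNode_pos hny (mem_Ico.1 hj).2.le).le
  have b1 := momentum_fst_by_parts hx hy hnx hny (T := t11) (S := t12) hex
  have b2 := momentum_snd_by_parts hx hy hnx hny (T := t22) (S := t12) hey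
  have p1 := poincare_fst hx hy hnx (e := ex) fun j hj => (hex j hj).1
  have p2 := poincare_snd hx hy hny (e := ey) fun i hi => (hey i hi).1
  have cM := weightedSum_mono hmx hmy fun i hi j hj =>
    compliance_coercive hl hm (h11 i (mem_range.1 hi) j (mem_range.1 hj))
      (h22 i (mem_range.1 hi) j (mem_range.1 hj))
  have cT := weightedSum_mono hnnx hnny fun i hi j hj =>
    neg_sq_le_mul_of_abs_sub_le (L := L) hm (by linarith)
      (h12 i (mem_range_succ_iff.1 hi) j (mem_range_succ_iff.1 hj))
  have c1 := weightedSum_mono (F := fun i j => _) hnix hmy fun i hi j hj =>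
    young_residual (e := ex i j) hm hL0
      (hg1 i (mem_Ico.1 hi).1 (mem_Ico.1 hi).2 j (mem_range.1 hj))
  have c2 := weightedSum_mono (F := fun i j => _) hmx hniy fun i hi j hj =>
    young_residual (e := ey i j) hm hL0
      (hg2 i (mem_range.1 hi) j (mem_Ico.1 hj).1 (mem_Ico.1 hj).2)
  rw [← hL] at cM
  simp only [weightedSum_add, weightedSum_const_mul, weightedSum_const, mul_add, hx.sum_hMid,
    hy.sum_hMid, hx.sum_hNode hnx, hy.sum_hNode hny, one_mul, mul_one] at cM cT c1 c2
  have s1 : -(2 * L / mu ^ 2 * γ ^ 2)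
      ≤ (∑ i ∈ Ico 1 nx, hNode x nx i) * -(2 * L / mu ^ 2 * γ ^ 2) := by
    have := mul_le_mul_of_nonneg_right (hx.sum_hNode_interior_le hnx)
      (by positivity : 0 ≤ 2 * L / mu ^ 2 * γ ^ 2)
    linarith
  have s2 : -(2 * L / mu ^ 2 * γ ^ 2)
      ≤ (∑ j ∈ Ico 1 ny, hNode y ny j) * -(2 * L / mu ^ 2 * γ ^ 2) := by
    have := mul_le_mul_of_nonneg_right (hy.sum_hNode_interior_le hny)
      (by positivity : 0 ≤ 2 * L / mu ^ 2 * γ ^ 2)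
    linarith
  have hδ : 0 ≤ mu ^ 2 / (8 * L) := by positivity
  have p1' := mul_le_mul_of_nonneg_left p1 hδ
  have p2' := mul_le_mul_of_nonneg_left p2 hδ
  rw [ipM_eq_weightedSum, ipM_eq_weightedSum, ← hL]
  have total : 1 / (4 * L) * (weightedSum (range nx) (range ny) (hMid x) (hMid y)
        (fun i j => t11 i j * t11 i j)
      + weightedSum (range nx) (range ny) (hMid x) (hMid y) (fun i j => t22 i j * t22 i j))
      ≤ L * (19 / 4 * ρ ^ 2 + 4 / mu ^ 2 * γ ^ 2) := by
    have e1 : 2 * L / mu ^ 2 * γ ^ 2 = L / 2 * (4 / mu ^ 2 * γ ^ 2) := by ring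
    rw [e1] at s1 s2 c1 c2
    linarith
  rw [one_div, inv_mul_le_iff₀ (by positivity)] at total
  refine total.trans (le_of_eq ?_)
  ring

lemma DerivBounds.correctedMid_eq_zero {N : ℝ} {g g1 g2 g3 : ℝ → ℝ} (h : DerivBounds N g g1 g2 g3)
    {x : ℕ → ℝ} {n : ℕ} (hx : IsGrid x n) (hg : ∀ t ∈ Set.Icc (0 : ℝ) 1, g t = 0) {i : ℕ}
    (hi : i < n) : correctedMid x g g2 i = 0 := by
  have deriv_zero : ∀ {f f' : ℝ → ℝ}, (∀ t, HasDerivAt f (f' t) t) →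
      (∀ t ∈ Set.Ioo (0 : ℝ) 1, f t = 0) → ∀ t ∈ Set.Ioo (0 : ℝ) 1, f' t = 0 := by
    intro f f' hd hf t ht
    refine (hd t).unique ((hasDerivAt_const t (0 : ℝ)).congr_of_eventuallyEq ?_)
    filter_upwards [Ioo_mem_nhds ht.1 ht.2] with s hs using hf s hs
  have hm := hx.midpt_mem_Ioo hi
  have h2 := deriv_zero h.d2 (deriv_zero h.d1 fun t ht => hg t (Set.Ioo_subset_Icc_self ht)) _ hm
  rw [correctedMid, hg _ (hx.midpt_mem hi), h2]
  simp

lemma DyE_sub (y : ℕ → ℝ) (n : ℕ) (v w : ℕ → ℕ → ℝ) {v0 vn : ℕ → ℝ} {i : ℕ}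
    (h : v0 i = 0 ∧ vn i = 0) (j : ℕ) :
    DyE y n (fun i j => v i j - w i j) 0 0 i j = DyE y n v v0 vn i j - DyE y n w 0 0 i j := by
  unfold DyE
  split_ifs
  · simp [h.1]; ring
  · simp [h.2]; ring
  · ring

lemma DxE_sub (x : ℕ → ℝ) (n : ℕ) (v w : ℕ → ℕ → ℝ) {v0 vn : ℕ → ℝ} {j : ℕ}
    (h : v0 j = 0 ∧ vn j = 0) (i : ℕ) :
    DxE x n (fun i j => v i j - w i j) 0 0 i j = DxE x n v v0 vn i j - DxE x n w 0 0 i j :=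
  DyE_sub x n (fun j i => v i j) (fun j i => w i j) h i

lemma compliance_stress {lam mu : ℝ} (hl : 0 < lam) (hm : 0 < mu) (a b : ℝ) :
    1 / (2 * mu) * (((lam + 2 * mu) * a + lam * b) - lam / (2 * lam + 2 * mu)
      * (((lam + 2 * mu) * a + lam * b) + (lam * a + (lam + 2 * mu) * b))) = a := by
  have h : lam + mu ≠ 0 := by positivity
  rw [show 2 * lam + 2 * mu = 2 * (lam + mu) by ring]
  field_simp
  ring

lemma abs_compliance_le {lam mu p q ε : ℝ} (hl : 0 < lam) (hm : 0 < mu) (hp : |p| ≤ ε)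
    (hq : |q| ≤ ε) :
    |1 / (2 * mu) * (p - lam / (2 * lam + 2 * mu) * (p + q))| ≤ 3 / (2 * mu) * ε := by
  have hk0 : 0 ≤ lam / (2 * lam + 2 * mu) := by positivity
  have hk1 : lam / (2 * lam + 2 * mu) ≤ 1 := by rw [div_le_one (by positivity)]; linarith
  generalize lam / (2 * lam + 2 * mu) = k at hk0 hk1 ⊢
  rw [abs_mul, abs_of_pos (by positivity : 0 < 1 / (2 * mu))]
  have h1 : |k * (p + q)| ≤ 2 * ε := by
    rw [abs_mul, abs_of_nonneg hk0]
    calc k * |p + q| ≤ 1 * |p + q| := by gcongr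
      _ ≤ |p| + |q| := by rw [one_mul]; exact abs_add_le p q
      _ ≤ 2 * ε := by linarith
  calc 1 / (2 * mu) * |p - k * (p + q)| ≤ 1 / (2 * mu) * (3 * ε) := by
        gcongr
        exact (abs_sub _ _).trans (by linarith)
    _ = _ := by ring

/-- The constitutive residual: `Z` solves the discrete constitutive law with displacement
difference `w`, `s` the exact one with displacement derivative `u`, and `e, v` interpolate
`s, u`. -/
lemma abs_constitutive_residual_le {lam mu p q e1 e2 s1 s2 w v u ε : ℝ} (hl : 0 < lam)
    (hm : 0 < mu)
    (hZ : 1 / (2 * mu) * (p - lam / (2 * lam + 2 * mu) * (p + q)) = w)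
    (hs : 1 / (2 * mu) * (s1 - lam / (2 * lam + 2 * mu) * (s1 + s2)) = u)
    (h1 : |e1 - s1| ≤ ε) (h2 : |e2 - s2| ≤ ε) (hv : |v - u| ≤ ε) :
    |1 / (2 * mu) * ((p - e1) - lam / (2 * lam + 2 * mu) * ((p - e1) + (q - e2))) - (w - v)|
      ≤ (2 + 3 / (2 * mu)) * ε := by
  have hA := abs_compliance_le hl hm h1 h2
  have hε : 0 ≤ ε := (abs_nonneg _).trans hv
  calc _ = |(v - u) - 1 / (2 * mu) * ((e1 - s1)
          - lam / (2 * lam + 2 * mu) * ((e1 - s1) + (e2 - s2)))| := by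
        rw [← hZ, ← hs]; congr 1; ring
    _ ≤ ε + 3 / (2 * mu) * ε := (abs_sub _ _).trans (add_le_add hv hA)
    _ ≤ _ := by linarith

/-- Superconvergence of the MAC-E scheme for the normal stresses: there are
`C, h₀ > 0` depending only on `μ` and the mesh-regularity constant `C₀`
(independent of `h` and `l`) such that, if `max(h,l) ≤ h₀`, then
`‖Z¹¹ - σ̃¹¹‖_M + ‖Z²² - σ̃²²‖_M ≤ C(λ+μ)(h²+l²)(‖u‖_{3,∞} + ‖σ‖_{3,∞})`. -/
theorem mac_superconvergence_normal_stresses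
    (mu C0 : ℝ) (hmu : 0 < mu) (hC0 : 0 < C0) :
    ∃ C > (0 : ℝ), ∃ h0 > (0 : ℝ), ∀ lam : ℝ, 0 < lam →
    ∀ (nx ny : ℕ), 2 ≤ nx → 2 ≤ ny → ∀ (x y : ℕ → ℝ),
    IsGrid x nx → IsGrid y ny →
    (∀ i < nx, C0 * max (hmax x nx) (hmax y ny) ≤ hMid x i) →
    (∀ j < ny, C0 * max (hmax x nx) (hmax y ny) ≤ hMid y j) →
    max (hmax x nx) (hmax y ny) ≤ h0 →
    ∀ ux uy : ℝ × ℝ → ℝ, ContDiff ℝ 3 ux → ContDiff ℝ 3 uy →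
    (∀ p : ℝ × ℝ, p ∈ Set.Icc ((0 : ℝ), (0 : ℝ)) ((1 : ℝ), (1 : ℝ)) →
      (p.1 = 0 ∨ p.1 = 1 ∨ p.2 = 0 ∨ p.2 = 1) → ux p = 0 ∧ uy p = 0) →
    ∀ s11 s22 s12 : ℝ × ℝ → ℝ,
    (∀ p, s11 p = (lam + 2 * mu) * pdx ux p + lam * pdy uy p) →
    (∀ p, s22 p = lam * pdx ux p + (lam + 2 * mu) * pdy uy p) →
    (∀ p, s12 p = mu * (pdy ux p + pdx uy p)) →
    ContDiff ℝ 3 s11 → ContDiff ℝ 3 s22 → ContDiff ℝ 3 s12 →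
    ∀ (Wx : ℕ → ℕ → ℝ) (Wx0 Wxn : ℕ → ℝ) (Wy : ℕ → ℕ → ℝ) (Wy0 Wyn : ℕ → ℝ)
      (Z11 Z22 Z12 : ℕ → ℕ → ℝ),
    MACESol nx ny x y lam mu Wx Wx0 Wxn Wy Wy0 Wyn Z11 Z22 Z12
      (fun i j => pdx s11 (x i, midpt y j) + pdy s12 (x i, midpt y j))
      (fun i j => pdx s12 (midpt x i, y j) + pdy s22 (midpt x i, y j)) →
    Real.sqrt (ipM x y nx ny
          (fun i j => Z11 i j - sigmaTilde x y s11 i j)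
          (fun i j => Z11 i j - sigmaTilde x y s11 i j))
      + Real.sqrt (ipM x y nx ny
          (fun i j => Z22 i j - sigmaTilde x y s22 i j)
          (fun i j => Z22 i j - sigmaTilde x y s22 i j))
      ≤ C * (lam + mu) * ((hmax x nx) ^ 2 + (hmax y ny) ^ 2)
          * (max (norm3 ux) (norm3 uy)
            + max (norm3 s11) (max (norm3 s22) (norm3 s12))) := by
  refine ⟨2 * (19 * (2 + 3 / (2 * mu)) ^ 2 + 64 / mu ^ 2 + 1), by positivity, 1, one_pos, ?_⟩
  intro lam hl nx ny hnx hny x y hx hy _ _ _ ux uy hux huy hbd s11 s22 s12 h11 h22 h12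
    hs11 hs22 hs12 Wx Wx0 Wxn Wy Wy0 Wyn Z11 Z22 Z12 hsol
  obtain ⟨hWx, hWx0, hWy, hWy0, hZ11, hZ22, hZ12, hf1, hf2⟩ := hsol
  obtain ⟨N, hN⟩ : ∃ N, N = max (norm3 ux) (norm3 uy)
    + max (norm3 s11) (max (norm3 s22) (norm3 s12)) := ⟨_, rfl⟩
  rw [← hN]
  have h0 : (0 : ℝ) ∈ Set.Icc (0 : ℝ) 1 := by simp
  have h1 : (1 : ℝ) ∈ Set.Icc (0 : ℝ) 1 := by simp
  have hu0 : 0 ≤ max (norm3 ux) (norm3 uy) :=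
    ((abs_nonneg _).trans (hux.squareBound_norm3.abs_le h0 h0)).trans (le_max_left _ _)
  have hs0 : 0 ≤ max (norm3 s11) (max (norm3 s22) (norm3 s12)) :=
    ((abs_nonneg _).trans (hs11.squareBound_norm3.abs_le h0 h0)).trans (le_max_left _ _)
  have bux : SquareBound 3 N ux :=
    hux.squareBound_norm3.mono (by linarith [le_max_left (norm3 ux) (norm3 uy)])
  have buy : SquareBound 3 N uy :=
    huy.squareBound_norm3.mono (by linarith [le_max_right (norm3 ux) (norm3 uy)])
  have bs11 : SquareBound 3 N s11 := hs11.squareBound_norm3.mono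
    (by linarith [le_max_left (norm3 s11) (max (norm3 s22) (norm3 s12))])
  have bs22 : SquareBound 3 N s22 := hs22.squareBound_norm3.mono
    (by linarith [le_max_right (norm3 s11) (max (norm3 s22) (norm3 s12)),
      le_max_left (norm3 s22) (norm3 s12)])
  have bs12 : SquareBound 3 N s12 := hs12.squareBound_norm3.mono
    (by linarith [le_max_right (norm3 s11) (max (norm3 s22) (norm3 s12)),
      le_max_right (norm3 s22) (norm3 s12)])
  have hN0 : 0 ≤ N := by rw [hN]; positivity
  have hnx0 : 0 < nx := by omega
  have hny0 : 0 < ny := by omega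
  obtain ⟨ε, hε⟩ : ∃ ε, ε = N * (hmax x nx ^ 2 + hmax y ny ^ 2) := ⟨_, rfl⟩
  have hε0 : 0 ≤ ε := by rw [hε]; positivity
  have hεx : N * hmax x nx ^ 2 ≤ ε := by
    rw [hε]; gcongr; exact le_add_of_nonneg_right (sq_nonneg _)
  have hεy : N * hmax y ny ^ 2 ≤ ε := by
    rw [hε]; gcongr; exact le_add_of_nonneg_left (sq_nonneg _)
  have zero_on : ∀ a ∈ Set.Icc (0 : ℝ) 1, ∀ b ∈ Set.Icc (0 : ℝ) 1,
      (a = 0 ∨ a = 1 ∨ b = 0 ∨ b = 1) → ux (a, b) = 0 ∧ uy (a, b) = 0 :=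
    fun a ha b hb hab => hbd (a, b) ⟨⟨ha.1, hb.1⟩, ⟨ha.2, hb.2⟩⟩ hab
  obtain ⟨vx, hvx⟩ : ∃ vx : ℕ → ℕ → ℝ, ∀ i j, vx i j =
      correctedMid y (fun t => ux (x i, t)) (fun t => pdy (pdy ux) (x i, t)) j :=
    ⟨_, fun _ _ => rfl⟩
  obtain ⟨vy, hvy⟩ : ∃ vy : ℕ → ℕ → ℝ, ∀ i j, vy i j =
      correctedMid x (fun s => uy (s, y j)) (fun s => pdx (pdx uy) (s, y j)) i :=
    ⟨_, fun _ _ => rfl⟩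
  have hvx0 : ∀ i ≤ nx, (x i = 0 ∨ x i = 1) → ∀ j < ny, vx i j = 0 := by
    intro i hi hxi j hj
    rw [hvx]
    refine (bux.derivBounds_snd (hx.mem_unit hi)).correctedMid_eq_zero hy (fun t ht => ?_) hj
    exact (zero_on _ (hx.mem_unit hi) t ht (hxi.imp_right Or.inl)).1
  have hvy0 : ∀ j ≤ ny, (y j = 0 ∨ y j = 1) → ∀ i < nx, vy i j = 0 := by
    intro j hj hyj i hi
    rw [hvy]
    refine (buy.derivBounds_fst (hy.mem_unit hj)).correctedMid_eq_zero hx (fun s hs => ?_) hi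
    exact (zero_on s hs _ (hy.mem_unit hj) (Or.inr (Or.inr hyj))).2
  have hex : ∀ j < ny, Wx 0 j - vx 0 j = 0 ∧ Wx nx j - vx nx j = 0 := fun j hj => by
    rw [(hWx j hj).1, (hWx j hj).2, hvx0 0 (Nat.zero_le _) (Or.inl hx.1) j hj,
      hvx0 nx le_rfl (Or.inr hx.2.1) j hj]
    simp
  have hey : ∀ i < nx, Wy i 0 - vy i 0 = 0 ∧ Wy i ny - vy i ny = 0 := fun i hi => by
    rw [(hWy i hi).1, (hWy i hi).2, hvy0 0 (Nat.zero_le _) (Or.inl hy.1) i hi,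
      hvy0 ny le_rfl (Or.inr hy.2.1) i hi]
    simp
  have main := mac_stability (ρ := (2 + 3 / (2 * mu)) * ε) (γ := 2 * ε) hl hmu hx hy hnx0 hny0
    (ex := fun i j => Wx i j - vx i j) (ey := fun i j => Wy i j - vy i j)
    (t11 := fun i j => Z11 i j - sigmaTilde x y s11 i j)
    (t22 := fun i j => Z22 i j - sigmaTilde x y s22 i j)
    (t12 := fun i j => Z12 i j - s12 (x i, y j)) hex hey
    (fun i hi j hj => by
      have e1 := abs_sigmaTilde_sub bs11 hx hy hi hj
      have e2 := abs_sigmaTilde_sub bs22 hx hy hi hj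
      have e3 := abs_edge_diff_fst bux hx hy hi hj
      rw [← hε] at e1 e2 e3
      rw [← hvx, ← hvx] at e3
      have hs := compliance_stress hl hmu (pdx ux (midpt x i, midpt y j))
        (pdy uy (midpt x i, midpt y j))
      rw [← h11, ← h22] at hs
      rw [show (Wx (i + 1) j - vx (i + 1) j - (Wx i j - vx i j)) / hMid x i
        = (Wx (i + 1) j - Wx i j) / hMid x i - (vx (i + 1) j - vx i j) / hMid x i by ring]
      exact abs_constitutive_residual_le hl hmu (hZ11 i hi j hj) hs e1 e2 e3)
    (fun i hi j hj => by
      have e1 := abs_sigmaTilde_sub bs11 hx hy hi hj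
      have e2 := abs_sigmaTilde_sub bs22 hx hy hi hj
      have e3 := abs_edge_diff_snd buy hx hy hi hj
      rw [← hε] at e1 e2 e3
      rw [← hvy, ← hvy] at e3
      have hs := compliance_stress hl hmu (pdy uy (midpt x i, midpt y j))
        (pdx ux (midpt x i, midpt y j))
      rw [add_comm ((lam + 2 * mu) * _), add_comm (lam * pdy uy _), ← h11, ← h22,
        add_comm (s22 _)] at hs
      rw [show (Wy i (j + 1) - vy i (j + 1) - (Wy i j - vy i j)) / hMid y j
        = (Wy i (j + 1) - Wy i j) / hMid y j - (vy i (j + 1) - vy i j) / hMid y j by ring]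
      rw [add_comm (Z11 i j - _)]
      have hZ := hZ22 i hi j hj
      rw [add_comm (Z11 i j)] at hZ
      rw [add_comm (s11 _)] at hs
      exact abs_constitutive_residual_le hl hmu hZ hs e2 e1 e3)
    (fun i hi j hj => by
      have e1 := (bux.derivBounds_snd (hx.mem_unit hi)).abs_DyE_correctedMid hy hny0
        (zero_on _ (hx.mem_unit hi) _ h0 (by simp)).1 (zero_on _ (hx.mem_unit hi) _ h1 (by simp)).1
        (w := vx) (i := i) (fun k _ => hvx i k) hj
      have e2 := (buy.derivBounds_fst (hy.mem_unit hj)).abs_DyE_correctedMid hx hnx0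
        (zero_on _ h0 _ (hy.mem_unit hj) (by simp)).2 (zero_on _ h1 _ (hy.mem_unit hj) (by simp)).2
        (w := fun j i => vy i j) (i := j) (fun k _ => hvy k j) hi
      rw [DyE_sub y ny Wx vx (hWx0 i hi), DxE_sub x nx Wy vy (hWy0 j hj), hZ12 i hi j hj, h12]
      change |DxE x nx vy 0 0 i j - _| ≤ _ at e2
      calc _ = |mu * ((DyE y ny vx 0 0 i j - pdy ux (x i, y j))
              + (DxE x nx vy 0 0 i j - pdx uy (x i, y j)))| := by congr 1; ring
        _ = mu * |(DyE y ny vx 0 0 i j - pdy ux (x i, y j))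
              + (DxE x nx vy 0 0 i j - pdx uy (x i, y j))| := by rw [abs_mul, abs_of_pos hmu]
        _ ≤ mu * ((2 + 3 / (2 * mu)) * ε) := by
          refine mul_le_mul_of_nonneg_left ((abs_add_le _ _).trans ?_) hmu.le
          have : 0 ≤ 3 / (2 * mu) * ε := by positivity
          linarith)
    (fun i hi1 hi j hj => by
      have e1 := abs_sigmaTilde_diff_fst bs11 hx hy hi1 hi hj
      have e2 := (bs12.derivBounds_snd (hx.mem_unit hi.le)).abs_node_diff hy hj
      rw [← hε] at e1
      have hf := hf1 i hi1 hi j hj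
      refine (le_of_eq ?_).trans ((abs_add_le _ _).trans
        ((add_le_add e1 (e2.trans hεy)).trans_eq (two_mul ε).symm))
      rw [← abs_neg]
      congr 1
      linear_combination -hf)
    (fun i hi j hj1 hj => by
      have e1 := abs_sigmaTilde_diff_snd bs22 hx hy hj1 hi hj
      have e2 := (bs12.derivBounds_fst (hy.mem_unit hj.le)).abs_node_diff hx hi
      rw [← hε] at e1
      have hf := hf2 i hi j hj1 hj
      refine (le_of_eq ?_).trans ((abs_add_le _ _).trans
        ((add_le_add e1 (e2.trans hεx)).trans_eq (two_mul ε).symm))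
      rw [← abs_neg]
      congr 1
      linear_combination -hf)
  obtain ⟨K, hK⟩ : ∃ K, K = 19 * (2 + 3 / (2 * mu)) ^ 2 + 64 / mu ^ 2 := ⟨_, rfl⟩
  have hK0 : 0 ≤ K := by rw [hK]; positivity
  have hbound : (lam + mu) ^ 2 * (19 * ((2 + 3 / (2 * mu)) * ε) ^ 2 + 16 / mu ^ 2 * (2 * ε) ^ 2)
      ≤ ((K + 1) * (lam + mu) * ε) ^ 2 := by
    calc _ = K * ((lam + mu) * ε) ^ 2 := by rw [hK]; ring
      _ ≤ (K + 1) ^ 2 * ((lam + mu) * ε) ^ 2 := by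
        gcongr
        nlinarith
      _ = _ := by ring
  have hR : 0 ≤ (K + 1) * (lam + mu) * ε := by positivity
  have ipM_nonneg : ∀ φ : ℕ → ℕ → ℝ, 0 ≤ ipM x y nx ny φ φ := fun φ => by
    refine sum_nonneg fun i hi => sum_nonneg fun j hj => ?_
    have h1 := hx.hMid_pos (mem_range.1 hi)
    have h2 := hy.hMid_pos (mem_range.1 hj)
    rw [mul_assoc]
    exact mul_nonneg (by positivity) (mul_self_nonneg _)
  have q1 := ipM_nonneg fun i j => Z11 i j - sigmaTilde x y s11 i j
  have q2 := ipM_nonneg fun i j => Z22 i j - sigmaTilde x y s22 i j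
  have r1 := Real.sqrt_le_iff.2 ⟨hR, (le_add_of_nonneg_right q2).trans (main.trans hbound)⟩
  have r2 := Real.sqrt_le_iff.2 ⟨hR, (le_add_of_nonneg_left q1).trans (main.trans hbound)⟩
  refine (add_le_add r1 r2).trans_eq ?_
  rw [← hK, hε]
  ring
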